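/- arXiv:0802.3209 — 4 statements merged into one kernel-verified Lean document; each statement's English description precedes it below -/
import Mathlib

section
/- The constant 1 in front of the right-hand side of the weighted Gårding inequality is sharp: for every c < 1 there exists a complex-valued u ∈ C_0^∞(ℝ² \ {0}) such that ∫_{ℝ²} |∇₂u|² · log(1/(e²|x|)) dx > c · Re ∫_{ℝ²} (Δ²u) · conj(u) · log(1/|x|) dx, where |∇₂u|² = |∂²u/∂x₁²|² + 2|∂²u/∂x₁∂x₂|² + |∂²u/∂x₂²|². -/
open MeasureTheory
open scoped Real

noncomputable section

/-- Euclidean plane. -/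
abbrev E2 := EuclideanSpace ℝ (Fin 2)

/-- Partial derivative of a complex-valued function on `ℝ²` in the `i`-th coordinate
direction. -/
def pd (i : Fin 2) (u : E2 → ℂ) (x : E2) : ℂ :=
  fderiv ℝ u x (EuclideanSpace.single i 1)

/-- The Laplacian of a complex-valued function on `ℝ²`. -/
def lap (u : E2 → ℂ) (x : E2) : ℂ :=
  pd 0 (pd 0 u) x + pd 1 (pd 1 u) x

/-- Squared norm of the full Hessian:
`|∇₂u|² = |u_{x₁x₁}|² + 2|u_{x₁x₂}|² + |u_{x₂x₂}|²`. -/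
def hess2 (u : E2 → ℂ) (x : E2) : ℝ :=
  ‖pd 0 (pd 0 u) x‖ ^ 2 + 2 * ‖pd 0 (pd 1 u) x‖ ^ 2 + ‖pd 1 (pd 1 u) x‖ ^ 2

/-- The plane wave of frequency `l` in the first coordinate direction, with constant factor `k`
and amplitude `g`. -/
def modulate (k : ℂ) (l : ℝ) (g : E2 → ℂ) (x : E2) : ℂ :=
  k * Complex.exp (Complex.I * (l * x 0 : ℝ)) * g x

/-- Rescaled partial derivative of a family `P t`, conjugated by the plane wave of frequency
`t⁻¹`. It makes sense also at `t = 0`, where it is multiplication by the principal symbol. -/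
def twistedPd (j : Fin 2) (P : ℝ → E2 → ℂ) (t : ℝ) (x : E2) : ℂ :=
  t * pd j (P t) x + (if j = 0 then Complex.I else 0) * P t x

/-- Conjugated and rescaled Laplacian of a family. -/
def twistedLap (P : ℝ → E2 → ℂ) (t : ℝ) (x : E2) : ℂ :=
  twistedPd 0 (twistedPd 0 P) t x + twistedPd 1 (twistedPd 1 P) t x

/-- A jointly smooth family of functions, all vanishing off `K`. -/
structure IsTestFamily (K : Set E2) (P : ℝ → E2 → ℂ) : Prop where
  contDiff : ContDiff ℝ (⊤ : ℕ∞) (Function.uncurry P)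
  eq_zero : ∀ t, ∀ x ∉ K, P t x = 0

namespace IsTestFamily

variable {K : Set E2} {P Q : ℝ → E2 → ℂ}

theorem continuous (hP : IsTestFamily K P) : Continuous (Function.uncurry P) :=
  hP.contDiff.continuous

theorem contDiff_apply (hP : IsTestFamily K P) (t : ℝ) : ContDiff ℝ (⊤ : ℕ∞) (P t) :=
  hP.contDiff.comp (contDiff_const.prodMk contDiff_id)

theorem differentiable (hP : IsTestFamily K P) (t : ℝ) : Differentiable ℝ (P t) :=
  (hP.contDiff_apply t).differentiable (by simp)

theorem twistedPd (hK : IsClosed K) (hP : IsTestFamily K P) (j : Fin 2) :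
    IsTestFamily K (twistedPd j P) where
  contDiff := by
    have hf : ContDiff ℝ (⊤ : ℕ∞)
        (fun p : ℝ × E2 => fderiv ℝ (P p.1) p.2 (EuclideanSpace.single j 1)) := by
      refine ContDiff.fderiv_apply (f := fun p : ℝ × E2 => P p.1) (m := ((⊤ : ℕ∞) : WithTop ℕ∞))
        ?_ contDiff_snd contDiff_const (by simp)
      exact hP.contDiff.comp ((contDiff_fst.comp contDiff_fst).prodMk contDiff_snd)
    have ht : ContDiff ℝ (⊤ : ℕ∞) (fun p : ℝ × E2 => (p.1 : ℂ)) :=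
      Complex.ofRealCLM.contDiff.comp contDiff_fst
    exact (ht.mul hf).add (contDiff_const.mul hP.contDiff)
  eq_zero t x hx := by
    have h : P t =ᶠ[nhds x] fun _ => 0 :=
      Filter.eventually_of_mem (hK.isOpen_compl.mem_nhds hx) fun y hy => hP.eq_zero t y hy
    simp [_root_.twistedPd, pd, h.fderiv_eq, hP.eq_zero t x hx]

theorem add (hP : IsTestFamily K P) (hQ : IsTestFamily K Q) :
    IsTestFamily K (fun t x => P t x + Q t x) where
  contDiff := hP.contDiff.add hQ.contDiff
  eq_zero t x hx := by simp [hP.eq_zero t x hx, hQ.eq_zero t x hx]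

theorem twistedLap (hK : IsClosed K) (hP : IsTestFamily K P) : IsTestFamily K (twistedLap P) :=
  ((hP.twistedPd hK 0).twistedPd hK 0).add ((hP.twistedPd hK 1).twistedPd hK 1)

end IsTestFamily

theorem twistedPd_at_zero (j : Fin 2) (P : ℝ → E2 → ℂ) (x : E2) :
    twistedPd j P 0 x = (if j = 0 then Complex.I else 0) * P 0 x := by
  simp [twistedPd]

theorem twistedLap_at_zero (P : ℝ → E2 → ℂ) (x : E2) : twistedLap P 0 x = -P 0 x := by
  simp [twistedLap, twistedPd_at_zero, ← mul_assoc]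

theorem norm_modulate (k : ℂ) (l : ℝ) (g : E2 → ℂ) (x : E2) :
    ‖modulate k l g x‖ = ‖k‖ * ‖g x‖ := by
  rw [modulate, norm_mul, norm_mul, mul_comm Complex.I, Complex.norm_exp_ofReal_mul_I, mul_one]

theorem modulate_mul_conj_modulate (k : ℂ) (l : ℝ) (f g : E2 → ℂ) (x : E2) :
    modulate k l f x * (starRingEnd ℂ) (modulate 1 l g x) = k * (f x * (starRingEnd ℂ) (g x)) := by
  have h : Complex.exp (Complex.I * (l * x 0 : ℝ)) *
      (starRingEnd ℂ) (Complex.exp (Complex.I * (l * x 0 : ℝ))) = 1 := by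
    rw [Complex.mul_conj', mul_comm Complex.I, Complex.norm_exp_ofReal_mul_I]
    simp
  simp only [modulate, map_mul, one_mul]
  linear_combination k * f x * (starRingEnd ℂ) (g x) * h

theorem contDiff_modulate (k : ℂ) (l : ℝ) {g : E2 → ℂ} {n : WithTop ℕ∞} (hg : ContDiff ℝ n g) :
    ContDiff ℝ n (modulate k l g) := by
  have h0 : ContDiff ℝ n (fun x : E2 => ((l * x 0 : ℝ) : ℂ)) :=
    Complex.ofRealCLM.contDiff.comp
      (contDiff_const.mul (EuclideanSpace.proj (𝕜 := ℝ) (0 : Fin 2)).contDiff)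
  exact (contDiff_const.mul (contDiff_const.mul h0).cexp).mul hg

theorem pd_modulate (j : Fin 2) (k : ℂ) {l : ℝ} (hl : l ≠ 0) {P : ℝ → E2 → ℂ}
    (hP : Differentiable ℝ (P l⁻¹)) :
    pd j (modulate k l (P l⁻¹)) = modulate (k * l) l (twistedPd j P l⁻¹) := by
  funext x
  have h0 : HasFDerivAt (fun x : E2 => ((l * x 0 : ℝ) : ℂ))
      (Complex.ofRealCLM.comp (l • EuclideanSpace.proj (𝕜 := ℝ) (0 : Fin 2))) x :=
    (Complex.ofRealCLM.comp (l • EuclideanSpace.proj (𝕜 := ℝ) (0 : Fin 2))).hasFDerivAt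
  have h1 := (((h0.const_mul Complex.I).cexp).const_mul k).mul (hP x).hasFDerivAt
  have h2 : pd j (modulate k l (P l⁻¹)) x = _ :=
    congrArg (fun L : E2 →L[ℝ] ℂ => L (EuclideanSpace.single j 1)) h1.fderiv
  have hl' : (l : ℂ) ≠ 0 := by exact_mod_cast hl
  rw [h2]
  fin_cases j <;> simp [modulate, twistedPd, pd] <;> field_simp

theorem lap_modulate (k : ℂ) {l : ℝ} (hl : l ≠ 0) {K : Set E2} (hK : IsClosed K)
    {P : ℝ → E2 → ℂ} (hP : IsTestFamily K P) :
    lap (modulate k l (P l⁻¹)) = modulate (k * l ^ 2) l (twistedLap P l⁻¹) := by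
  funext x
  rw [lap, pd_modulate 0 k hl (hP.differentiable _), pd_modulate 1 k hl (hP.differentiable _),
    pd_modulate 0 _ hl ((hP.twistedPd hK 0).differentiable _),
    pd_modulate 1 _ hl ((hP.twistedPd hK 1).differentiable _)]
  simp only [modulate, twistedLap]
  ring

/-- Rescaled squared norm of the Hessian of a modulated family. -/
def twistedHess2 (P : ℝ → E2 → ℂ) (t : ℝ) (x : E2) : ℝ :=
  ‖twistedPd 0 (twistedPd 0 P) t x‖ ^ 2 + 2 * ‖twistedPd 0 (twistedPd 1 P) t x‖ ^ 2 +
    ‖twistedPd 1 (twistedPd 1 P) t x‖ ^ 2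

theorem twistedHess2_at_zero (P : ℝ → E2 → ℂ) (x : E2) : twistedHess2 P 0 x = ‖P 0 x‖ ^ 2 := by
  simp [twistedHess2, twistedPd_at_zero]

theorem hess2_modulate {l : ℝ} (hl : l ≠ 0) {K : Set E2} (hK : IsClosed K)
    {P : ℝ → E2 → ℂ} (hP : IsTestFamily K P) (x : E2) :
    hess2 (modulate 1 l (P l⁻¹)) x = l ^ 4 * twistedHess2 P l⁻¹ x := by
  rw [hess2, pd_modulate 0 1 hl (hP.differentiable _), pd_modulate 1 1 hl (hP.differentiable _),
    pd_modulate 0 _ hl ((hP.twistedPd hK 0).differentiable _),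
    pd_modulate 0 _ hl ((hP.twistedPd hK 1).differentiable _),
    pd_modulate 1 _ hl ((hP.twistedPd hK 1).differentiable _)]
  have h : ‖(1 * l * l : ℂ)‖ ^ 2 = l ^ 4 := by
    rw [← Complex.ofReal_one, ← Complex.ofReal_mul, ← Complex.ofReal_mul, Complex.norm_real,
      Real.norm_eq_abs, sq_abs]
    ring
  simp only [norm_modulate, mul_pow, h, twistedHess2]
  ring

/-- High-frequency limit: if the weighted mass of `|P 0|²` is positive, then the plane waves
modulating the family `P` eventually satisfy the corresponding inequality for the weighted
Hessian and bilaplacian integrals. -/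
theorem exists_modulate_integral_lt {K : Set E2} (hK : IsCompact K) {P : ℝ → E2 → ℂ}
    (hP : IsTestFamily K P) {v w : E2 → ℝ} (hv : Continuous v) (hw : Continuous w) {c : ℝ}
    (hpos : c * ∫ x in K, ‖P 0 x‖ ^ 2 * w x < ∫ x in K, ‖P 0 x‖ ^ 2 * v x) :
    ∃ l : ℝ, l ≠ 0 ∧
      c * (∫ x in K, lap (lap (modulate 1 l (P l⁻¹))) x *
        (starRingEnd ℂ) (modulate 1 l (P l⁻¹) x) * (w x : ℂ)).re <
      ∫ x in K, hess2 (modulate 1 l (P l⁻¹)) x * v x := by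
  have hKc := hK.isClosed
  have hA : Continuous (fun t => ∫ x in K, twistedHess2 P t x * v x) := by
    refine continuous_parametric_integral_of_continuous
      (f := fun t x => twistedHess2 P t x * v x) ?_ hK
    have h00 := ((hP.twistedPd hKc 0).twistedPd hKc 0).continuous
    have h01 := ((hP.twistedPd hKc 1).twistedPd hKc 0).continuous
    have h11 := ((hP.twistedPd hKc 1).twistedPd hKc 1).continuous
    exact (((h00.norm.pow 2).add (continuous_const.mul (h01.norm.pow 2))).add
      (h11.norm.pow 2)).mul (hv.comp continuous_snd)
  have hB : Continuous (fun t => ∫ x in K,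
      twistedLap (twistedLap P) t x * (starRingEnd ℂ) (P t x) * (w x : ℂ)) := by
    refine continuous_parametric_integral_of_continuous
      (f := fun t x => twistedLap (twistedLap P) t x * (starRingEnd ℂ) (P t x) * (w x : ℂ)) ?_ hK
    exact (((hP.twistedLap hKc).twistedLap hKc).continuous.mul
      (Complex.continuous_conj.comp hP.continuous)).mul
        (Complex.continuous_ofReal.comp (hw.comp continuous_snd))
  have hB0 : ∫ x in K, twistedLap (twistedLap P) 0 x * (starRingEnd ℂ) (P 0 x) * (w x : ℂ) =
      ((∫ x in K, ‖P 0 x‖ ^ 2 * w x : ℝ) : ℂ) := by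
    rw [← integral_complex_ofReal]
    congr 1
    funext x
    rw [twistedLap_at_zero, twistedLap_at_zero, neg_neg, Complex.mul_conj']
    simp
  have hev : ∀ᶠ t in nhds (0 : ℝ),
      c * (∫ x in K, twistedLap (twistedLap P) t x * (starRingEnd ℂ) (P t x) * (w x : ℂ)).re <
        ∫ x in K, twistedHess2 P t x * v x := by
    refine (continuous_const.mul (Complex.continuous_re.comp hB)).continuousAt.eventually_lt
      hA.continuousAt ?_
    simpa only [Pi.mul_apply, Function.comp, hB0, Complex.ofReal_re, twistedHess2_at_zero] using hpos
  obtain ⟨t, ht, ht0⟩ :=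
    ((hev.filter_mono nhdsWithin_le_nhds).and (self_mem_nhdsWithin (s := {(0 : ℝ)}ᶜ))).exists
  have ht0 : t ≠ 0 := ht0
  have hl : t⁻¹ ≠ 0 := inv_ne_zero ht0
  refine ⟨t⁻¹, hl, ?_⟩
  have h1 : ∀ x, lap (lap (modulate 1 t⁻¹ (P t⁻¹⁻¹))) x *
      (starRingEnd ℂ) (modulate 1 t⁻¹ (P t⁻¹⁻¹) x) * (w x : ℂ) =
      ((t⁻¹ ^ 4 : ℝ) : ℂ) *
        (twistedLap (twistedLap P) t x * (starRingEnd ℂ) (P t x) * (w x : ℂ)) := fun x => by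
    rw [lap_modulate 1 hl hKc hP, lap_modulate _ hl hKc (hP.twistedLap hKc),
      modulate_mul_conj_modulate, inv_inv]
    push_cast
    ring
  have h2 : ∀ x, hess2 (modulate 1 t⁻¹ (P t⁻¹⁻¹)) x * v x =
      t⁻¹ ^ 4 * (twistedHess2 P t x * v x) := fun x => by
    rw [hess2_modulate hl hKc hP, inv_inv, mul_assoc]
  simp only [h1, h2, integral_const_mul, Complex.re_ofReal_mul]
  have : 0 < t⁻¹ ^ 4 := by positivity
  nlinarith [mul_lt_mul_of_pos_left ht this]

/-- Sharpness of the constant `1` in the weighted Gårding inequality: for any `c < 1`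
some test function supported away from the origin violates the inequality with `c`. -/
theorem weighted_garding_inequality_sharp :
    ∀ c : ℝ, c < 1 → ∃ u : E2 → ℂ, ContDiff ℝ (⊤ : ℕ∞) u ∧ HasCompactSupport u ∧
      (0 : E2) ∉ tsupport u ∧
      c * (∫ x : E2, lap (lap u) x * (starRingEnd ℂ) (u x) *
          (Real.log (1 / ‖x‖) : ℂ)).re <
        ∫ x : E2, hess2 u x * Real.log (1 / (Real.exp 2 * ‖x‖)) := by
  intro c hc
  set M : ℝ := 2 / (1 - c) + 1 with hM
  set r : ℝ := Real.exp (-M) / 3 with hr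
  have hr0 : 0 < r := by positivity
  set p : E2 := EuclideanSpace.single 0 (2 * r) with hp
  have hpn : ‖p‖ = 2 * r := by
    simp [hp, abs_of_pos hr0]
  set K : Set E2 := Metric.closedBall p r with hKdef
  have hK : IsCompact K := isCompact_closedBall p r
  have hKr : ∀ x ∈ K, r ≤ ‖x‖ ∧ ‖x‖ ≤ 3 * r := fun x hx => by
    have h1 : ‖x - p‖ ≤ r := by simpa [hKdef, dist_eq_norm] using hx
    have h2 := norm_sub_norm_le p x
    have h3 := norm_sub_norm_le x p
    rw [norm_sub_rev] at h2
    constructor <;> linarith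
  let f : ContDiffBump p := ⟨r / 2, r, by positivity, by linarith⟩
  have hf0 : ∀ x ∉ K, f x = 0 := fun x hx =>
    f.zero_of_le_dist (not_le.1 (by simpa [hKdef] using hx)).le
  have hP : IsTestFamily K (fun _ x => (f x : ℂ)) :=
    ⟨Complex.ofRealCLM.contDiff.comp (f.contDiff.comp contDiff_snd),
      fun _ x hx => by simp [hf0 x hx]⟩
  set w : E2 → ℝ := fun x => -Real.log (max ‖x‖ r) with hwdef
  have hw : Continuous w :=
    ((continuous_norm.max continuous_const).log
      fun x => (lt_max_of_lt_right hr0).ne').neg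
  have hwM : ∀ x ∈ K, M ≤ w x := fun x hx => by
    obtain ⟨h1, h2⟩ := hKr x hx
    have h3 : Real.log ‖x‖ ≤ -M :=
      (Real.log_le_iff_le_exp (by linarith)).2 (h2.trans_eq (by rw [hr]; ring))
    simp only [hwdef, max_eq_left h1]
    linarith
  have hlog : ∀ x ∈ K, Real.log (1 / ‖x‖) = w x ∧
      Real.log (1 / (Real.exp 2 * ‖x‖)) = w x - 2 := fun x hx => by
    obtain ⟨h1, -⟩ := hKr x hx
    have h3 : ‖x‖ ≠ 0 := by linarith
    simp only [hwdef, max_eq_left h1, one_div, Real.log_inv,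
      Real.log_mul (Real.exp_ne_zero 2) h3, Real.log_exp]
    exact ⟨trivial, by ring⟩
  have hfw : Continuous fun x => f x ^ 2 * w x := (f.continuous.pow 2).mul hw
  have hfv : Continuous fun x => f x ^ 2 * (w x - 2) :=
    (f.continuous.pow 2).mul (hw.sub continuous_const)
  have hpos : c * ∫ x in K, ‖(f x : ℂ)‖ ^ 2 * w x < ∫ x in K, ‖(f x : ℂ)‖ ^ 2 * (w x - 2) := by
    have hgap : ∀ x ∈ K, 0 < (1 - c) * w x - 2 := fun x hx => by
      have h1 : 0 < 1 - c := by linarith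
      have h2 : (1 - c) * M = 2 + (1 - c) := by rw [hM]; field_simp
      nlinarith [mul_le_mul_of_nonneg_left (hwM x hx) h1.le]
    have hmass : 0 < ∫ x, f x ^ 2 * ((1 - c) * w x - 2) := by
      refine Continuous.integral_pos_of_hasCompactSupport_nonneg_nonzero (x := p)
        ((f.continuous.pow 2).mul ((continuous_const.mul hw).sub continuous_const)) ?_ ?_ ?_
      · exact HasCompactSupport.intro hK fun x hx => by simp [hf0 x hx]
      · intro x
        by_cases hx : x ∈ K
        · exact mul_nonneg (sq_nonneg _) (hgap x hx).le
        · simp [hf0 x hx]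
      · have h1 := hgap p (Metric.mem_closedBall_self hr0.le)
        have h2 : 0 < f p := f.pos_of_mem_ball (Metric.mem_ball_self hr0)
        positivity
    simp only [Complex.norm_real, Real.norm_eq_abs, sq_abs]
    rw [← setIntegral_eq_integral_of_forall_compl_eq_zero (s := K)
      fun x hx => by simp [hf0 x hx]] at hmass
    rw [← sub_pos, ← integral_const_mul, ← integral_sub (hfv.continuousOn.integrableOn_compact hK)
      ((hfw.continuousOn.integrableOn_compact hK).const_mul c)]
    refine hmass.trans_eq (integral_congr_ae (.of_forall fun x => ?_))
    ring
  obtain ⟨l, hl, hlt⟩ :=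
    exists_modulate_integral_lt hK hP (hw.sub continuous_const) hw hpos
  have hu0 : ∀ x ∉ K, modulate 1 l (fun x => (f x : ℂ)) x = 0 := fun x hx => by
    simp [modulate, hf0 x hx]
  refine ⟨modulate 1 l (fun x => (f x : ℂ)), contDiff_modulate 1 l (hP.contDiff_apply 0),
    HasCompactSupport.intro hK hu0, fun h => ?_, ?_⟩
  · have h1 := (hKr 0 (closure_minimal (Function.support_subset_iff'.2 hu0) hK.isClosed h)).1
    rw [norm_zero] at h1
    linarith
  · have h1 : ∀ x ∉ K, hess2 (modulate 1 l fun x => (f x : ℂ)) x = 0 := fun x hx => by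
      rw [hess2_modulate hl hK.isClosed hP, twistedHess2,
        ((hP.twistedPd hK.isClosed 0).twistedPd hK.isClosed 0).eq_zero _ x hx,
        ((hP.twistedPd hK.isClosed 1).twistedPd hK.isClosed 0).eq_zero _ x hx,
        ((hP.twistedPd hK.isClosed 1).twistedPd hK.isClosed 1).eq_zero _ x hx]
      simp
    rw [← setIntegral_eq_integral_of_forall_compl_eq_zero (s := K)
        fun x hx => by rw [hu0 x hx, map_zero, mul_zero, zero_mul],
      ← setIntegral_eq_integral_of_forall_compl_eq_zero (s := K)
        (f := fun x => hess2 _ x * _) fun x hx => by rw [h1 x hx, zero_mul],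
      setIntegral_congr_fun hK.measurableSet fun x hx => by rw [(hlog x hx).1],
      setIntegral_congr_fun (f := fun x => hess2 _ x * _)
        (g := fun x => hess2 (modulate 1 l fun x => (f x : ℂ)) x * (w x - 2))
        hK.measurableSet fun x hx => by simp only [(hlog x hx).2]]
    exact hlt
end
end

section
/- Let n ≥ 2 and let q be a locally integrable nonnegative function on (0,1). Define λ as the infimum, over all smooth functions y on [0, π/2] for which ∫_0^{π/2} |y(φ)|² q(sin φ) dφ is positive and finite, of the ratio ( ∫_0^{π/2} ( |y'(φ)|² + (1/4)|y(φ)|² ) sin φ dφ ) / ( ∫_0^{π/2} |y(φ)|² q(sin φ) dφ ). Then for every u ∈ C_0^∞(closure of ℝⁿ₊) the inequality ∫_{ℝⁿ₊} x_n |∇u|² dx ≥ λ · ∫_{ℝⁿ₊} q( x_n/(x_{n-1}² + x_n²)^{1/2} ) · |u|² · (x_{n-1}² + x_n²)^{−1/2} dx holds. -/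
open MeasureTheory
open scoped Real

noncomputable section

/-- Partial derivative of a real-valued function on `ℝⁿ` in the `i`-th coordinate
direction. -/
def pdn {n : ℕ} (i : Fin n) (u : EuclideanSpace ℝ (Fin n) → ℝ)
    (x : EuclideanSpace ℝ (Fin n)) : ℝ :=
  fderiv ℝ u x (EuclideanSpace.single i 1)

/-- The variational quantity
`λ = inf ( ∫₀^{π/2} (|y'|² + |y|²/4) sin φ dφ ) / ( ∫₀^{π/2} |y|² q(sin φ) dφ )`,
the infimum being over smooth `y` on `[0, π/2]` whose denominator is positive
and finite. -/
def lamQ (q : ℝ → ℝ) : ℝ :=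
  sInf { r : ℝ | ∃ y : ℝ → ℝ, ContDiffOn ℝ (⊤ : ℕ∞) y (Set.Icc 0 (π / 2)) ∧
    IntegrableOn (fun φ => (y φ) ^ 2 * q (Real.sin φ)) (Set.Ioo 0 (π / 2)) ∧
    (0 < ∫ φ in Set.Ioo (0 : ℝ) (π / 2), (y φ) ^ 2 * q (Real.sin φ)) ∧
    r = (∫ φ in Set.Ioo (0 : ℝ) (π / 2),
          ((deriv y φ) ^ 2 + (1 / 4) * (y φ) ^ 2) * Real.sin φ) /
        (∫ φ in Set.Ioo (0 : ℝ) (π / 2), (y φ) ^ 2 * q (Real.sin φ)) }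

open Set in
theorem lamQ_mul_le_quarter (q : ℝ → ℝ) (y : ℝ → ℝ) (hy : ContDiff ℝ (⊤ : ℕ∞) y) :
    lamQ q * ∫ φ in Ioo (0 : ℝ) (π / 2), (y φ) ^ 2 * q (Real.sin φ) ≤
      ∫ φ in Ioo (0 : ℝ) (π / 2), ((deriv y φ) ^ 2 + (1 / 4) * (y φ) ^ 2) * Real.sin φ := by
  have energy_nonneg (z : ℝ → ℝ) : 0 ≤ ∫ φ in Ioo (0 : ℝ) (π / 2),
      ((deriv z φ) ^ 2 + (1 / 4) * (z φ) ^ 2) * Real.sin φ := by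
    refine setIntegral_nonneg measurableSet_Ioo fun φ hφ => ?_
    have := Real.sin_nonneg_of_nonneg_of_le_pi hφ.1.le (by linarith [hφ.2, Real.pi_pos])
    positivity
  have quotient_nonneg : ∀ r ∈ { r : ℝ | ∃ y : ℝ → ℝ,
      ContDiffOn ℝ (⊤ : ℕ∞) y (Set.Icc 0 (π / 2)) ∧
      IntegrableOn (fun φ => (y φ) ^ 2 * q (Real.sin φ)) (Set.Ioo 0 (π / 2)) ∧
      (0 < ∫ φ in Set.Ioo (0 : ℝ) (π / 2), (y φ) ^ 2 * q (Real.sin φ)) ∧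
      r = (∫ φ in Set.Ioo (0 : ℝ) (π / 2),
          ((deriv y φ) ^ 2 + (1 / 4) * (y φ) ^ 2) * Real.sin φ) /
        (∫ φ in Set.Ioo (0 : ℝ) (π / 2), (y φ) ^ 2 * q (Real.sin φ)) }, 0 ≤ r := by
    rintro r ⟨z, -, -, hpos, rfl⟩
    exact div_nonneg (energy_nonneg z) hpos.le
  by_cases hpos : 0 < ∫ φ in Ioo (0 : ℝ) (π / 2), (y φ) ^ 2 * q (Real.sin φ)
  · rw [← le_div_iff₀ hpos]
    refine csInf_le ⟨0, quotient_nonneg⟩ ⟨y, hy.contDiffOn, ?_, hpos, rfl⟩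
    by_contra h_fin
    exact hpos.ne' (integral_undef h_fin)
  · exact (mul_nonpos_of_nonneg_of_nonpos (Real.sInf_nonneg quotient_nonneg)
      (not_lt.mp hpos)).trans (energy_nonneg y)

open Set in
theorem lamQ_mul_le_half (q : ℝ → ℝ) (y : ℝ → ℝ) (hy : ContDiff ℝ (⊤ : ℕ∞) y) :
    lamQ q * ∫ φ in Ioo (0 : ℝ) π, (y φ) ^ 2 * q (Real.sin φ) ≤
      ∫ φ in Ioo (0 : ℝ) π, ((deriv y φ) ^ 2 + (1 / 4) * (y φ) ^ 2) * Real.sin φ := by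
  have hpi := Real.pi_pos
  by_cases h_fin : IntegrableOn (fun φ => (y φ) ^ 2 * q (Real.sin φ)) (Ioo 0 π)
  swap
  · rw [integral_undef h_fin, mul_zero]
    refine setIntegral_nonneg measurableSet_Ioo fun φ hφ => ?_
    have := Real.sin_nonneg_of_nonneg_of_le_pi hφ.1.le hφ.2.le
    positivity
  have split (f : ℝ → ℝ) (hf : IntegrableOn f (Ioo 0 π)) :
      ∫ φ in Ioo (0 : ℝ) π, f φ =
        (∫ φ in Ioo (0 : ℝ) (π / 2), f φ) + ∫ φ in Ioo (0 : ℝ) (π / 2), f (π - φ) := by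
    have hf' : IntervalIntegrable f volume 0 π := by
      rwa [intervalIntegrable_iff_integrableOn_Ioo_of_le hpi.le]
    simp only [← integral_Ioc_eq_integral_Ioo]
    rw [← intervalIntegral.integral_of_le hpi.le, ← intervalIntegral.integral_of_le (by linarith),
      ← intervalIntegral.integral_of_le (by linarith), intervalIntegral.integral_comp_sub_left,
      sub_zero, show π - π / 2 = π / 2 by ring, intervalIntegral.integral_add_adjacent_intervals]
    · exact hf'.mono_set (by
        rw [uIcc_of_le (by linarith), uIcc_of_le hpi.le]
        exact Icc_subset_Icc le_rfl (by linarith))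
    · exact hf'.mono_set (by
        rw [uIcc_of_le (by linarith), uIcc_of_le hpi.le]
        exact Icc_subset_Icc (by linarith) le_rfl)
  have hdy : Continuous (deriv y) := hy.continuous_deriv (by simp)
  have hcy := hy.continuous
  rw [split _ h_fin,
    split _ ((Continuous.integrableOn_Icc (by fun_prop)).mono_set Ioo_subset_Icc_self), mul_add]
  refine add_le_add (lamQ_mul_le_quarter q y hy) ?_
  have reflected := lamQ_mul_le_quarter q (fun φ => y (π - φ)) (hy.comp (by fun_prop))
  simpa [deriv_comp_const_sub] using reflected

open Set in
/-- The one-dimensional Hardy inequality with constant one quarter and weight `r²`. -/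
theorem hardy_Ioi {v v' : ℝ → ℝ} (hv : ∀ r, HasDerivAt v (v' r) r) (hv' : Continuous v')
    {R : ℝ} (hsupp : ∀ r, R < r → v r = 0) (hsupp' : ∀ r, R < r → v' r = 0) :
    0 ≤ ∫ r in Ioi (0 : ℝ), (r ^ 2 * (v' r) ^ 2 - (1 / 4) * (v r) ^ 2) := by
  have hvc : Continuous v := continuous_iff_continuousAt.2 fun r => (hv r).continuousAt
  have integrable (f : ℝ → ℝ) (hf : Continuous f) (hf0 : ∀ r, R < r → f r = 0) :
      IntegrableOn f (Ioi 0) := by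
    refine IntegrableOn.of_forall_sdiff_eq_zero (s := Icc 0 R) hf.integrableOn_Icc
      measurableSet_Ioi fun r hr => hf0 r ?_
    by_contra hle
    exact hr.2 ⟨le_of_lt hr.1, not_lt.mp hle⟩
  have exact_integrable : IntegrableOn (fun r => (v r) ^ 2 + r * (2 * v r * v' r)) (Ioi 0) :=
    integrable _ (by fun_prop) fun r hr => by simp [hsupp r hr]
  have exact_integral : ∫ r in Ioi (0 : ℝ), ((v r) ^ 2 + r * (2 * v r * v' r)) = 0 := by
    have := integral_Ioi_of_hasDerivAt_of_tendsto (a := 0) (m := 0) (f := fun r => r * (v r) ^ 2)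
      (f' := fun r => (v r) ^ 2 + r * (2 * v r * v' r)) (by fun_prop)
      (fun r _ => by
        refine ((hasDerivAt_id r).mul ((hv r).pow 2)).congr_deriv ?_
        simp) exact_integrable
      (tendsto_const_nhds.congr' (by
        filter_upwards [Filter.eventually_gt_atTop R] with r hr
        simp [hsupp r hr]))
    simpa using this
  have square_integrable : IntegrableOn (fun r => (r * v' r + v r / 2) ^ 2) (Ioi 0) :=
    integrable _ (by fun_prop) fun r hr => by simp [hsupp r hr, hsupp' r hr]
  have : ∫ r in Ioi (0 : ℝ), (r ^ 2 * (v' r) ^ 2 - (1 / 4) * (v r) ^ 2) =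
      ∫ r in Ioi (0 : ℝ), ((r * v' r + v r / 2) ^ 2 -
        (1 / 2) * ((v r) ^ 2 + r * (2 * v r * v' r))) := by
    congr 1 with r
    ring
  rw [this, integral_sub square_integrable (exact_integrable.const_mul _), integral_const_mul,
    exact_integral, mul_zero, sub_zero]
  exact integral_nonneg fun r => sq_nonneg _

open Set in
theorem polarCoord_symm_image_upper :
    polarCoord.symm '' (Ioi 0 ×ˢ Ioo 0 π) = {p : ℝ × ℝ | 0 < p.2} := by
  ext p
  constructor
  · rintro ⟨⟨r, φ⟩, ⟨hr, hφ⟩, rfl⟩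
    exact mul_pos hr (Real.sin_pos_of_pos_of_lt_pi hφ.1 hφ.2)
  · intro hp
    have hs : p ∈ polarCoord.source := Or.inr (ne_of_gt hp)
    have ht := polarCoord.map_source hs
    have hinv := polarCoord.left_inv hs
    refine ⟨polarCoord p, ⟨ht.1, ?_, ht.2.2⟩, hinv⟩
    by_contra hle
    have h2 : (polarCoord p).1 * Real.sin (polarCoord p).2 = p.2 := congrArg Prod.snd hinv
    have := Real.sin_nonpos_of_nonpos_of_neg_pi_le (not_lt.mp hle) ht.2.1.le
    have := mul_nonpos_of_nonneg_of_nonpos (le_of_lt ht.1) this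
    rw [h2] at this
    exact absurd hp (not_lt.mpr this)

open Set in
theorem polarCoord_symm_injOn_upper :
    InjOn polarCoord.symm ((Ioi 0 : Set ℝ) ×ˢ Ioo 0 π) :=
  polarCoord.symm.injOn.mono
    (prod_mono le_rfl (Ioo_subset_Ioo (by linarith [Real.pi_pos]) le_rfl))

open Set in
theorem setIntegral_upper_eq_polar (f : ℝ × ℝ → ℝ) :
    ∫ p in {p : ℝ × ℝ | 0 < p.2}, f p =
      ∫ p in (Ioi 0 : Set ℝ) ×ˢ Ioo 0 π, p.1 * f (polarCoord.symm p) := by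
  have hS : MeasurableSet ((Ioi 0 : Set ℝ) ×ˢ Ioo 0 π) := measurableSet_Ioi.prod measurableSet_Ioo
  rw [← polarCoord_symm_image_upper, integral_image_eq_integral_abs_det_fderiv_smul volume hS
    (fun p _ => (hasFDerivAt_polarCoord_symm p).hasFDerivWithinAt) polarCoord_symm_injOn_upper]
  refine setIntegral_congr_fun hS fun p hp => ?_
  simp only [det_fderivPolarCoordSymm, abs_of_pos (show 0 < p.1 from hp.1), smul_eq_mul]

open Set in
theorem integrableOn_polar_of_upper {f : ℝ × ℝ → ℝ} (hf : IntegrableOn f {p : ℝ × ℝ | 0 < p.2}) :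
    IntegrableOn (fun p => p.1 * f (polarCoord.symm p)) ((Ioi 0 : Set ℝ) ×ˢ Ioo 0 π) := by
  have hS : MeasurableSet ((Ioi 0 : Set ℝ) ×ˢ Ioo 0 π) := measurableSet_Ioi.prod measurableSet_Ioo
  rw [← polarCoord_symm_image_upper, integrableOn_image_iff_integrableOn_abs_det_fderiv_smul
    volume hS (fun p _ => (hasFDerivAt_polarCoord_symm p).hasFDerivWithinAt)
    polarCoord_symm_injOn_upper] at hf
  refine hf.congr_fun (fun p hp => ?_) hS
  simp only [det_fderivPolarCoordSymm, abs_of_pos (show 0 < p.1 from hp.1), smul_eq_mul]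

open Set in
theorem integrableOn_polar_strip {F : ℝ × ℝ → ℝ} (hF : Continuous F) {R : ℝ}
    (hF0 : ∀ p, R < p.1 → F p = 0) : IntegrableOn F ((Ioi 0 : Set ℝ) ×ˢ Ioo 0 π) := by
  refine IntegrableOn.of_forall_sdiff_eq_zero (s := Icc 0 R ×ˢ Icc 0 π)
    (hF.continuousOn.integrableOn_compact (isCompact_Icc.prod isCompact_Icc))
    (measurableSet_Ioi.prod measurableSet_Ioo) fun p hp => hF0 p ?_
  by_contra hle
  exact hp.2 ⟨⟨le_of_lt hp.1.1, not_lt.mp hle⟩, hp.1.2.1.le, hp.1.2.2.le⟩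

open Set in
theorem weighted_hardy_half_plane (q : ℝ → ℝ) (w : ℝ × ℝ → ℝ) (hw : ContDiff ℝ (⊤ : ℕ∞) w)
    (hc : HasCompactSupport w) :
    lamQ q * ∫ p in {p : ℝ × ℝ | 0 < p.2},
        q (p.2 / √(p.1 ^ 2 + p.2 ^ 2)) * (w p) ^ 2 / √(p.1 ^ 2 + p.2 ^ 2) ≤
      ∫ p in {p : ℝ × ℝ | 0 < p.2},
        p.2 * ((fderiv ℝ w p (1, 0)) ^ 2 + (fderiv ℝ w p (0, 1)) ^ 2) := by
  have hS : MeasurableSet ((Ioi 0 : Set ℝ) ×ˢ Ioo 0 π) := measurableSet_Ioi.prod measurableSet_Ioo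
  by_cases h_fin : IntegrableOn (fun p : ℝ × ℝ =>
      q (p.2 / √(p.1 ^ 2 + p.2 ^ 2)) * (w p) ^ 2 / √(p.1 ^ 2 + p.2 ^ 2)) {p : ℝ × ℝ | 0 < p.2}
  swap
  · rw [integral_undef h_fin, mul_zero]
    exact setIntegral_nonneg (measurableSet_lt measurable_const measurable_snd)
      fun p hp => mul_nonneg (le_of_lt hp) (by positivity)
  set wa : ℝ × ℝ → ℝ := fun p => fderiv ℝ w p (1, 0) with hwa
  set wb : ℝ × ℝ → ℝ := fun p => fderiv ℝ w p (0, 1) with hwb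
  have hdw : Continuous (fderiv ℝ w) := hw.continuous_fderiv (by simp)
  have hwac : Continuous wa := hdw.clm_apply continuous_const
  have hwbc : Continuous wb := hdw.clm_apply continuous_const
  have hwc := hw.continuous
  obtain ⟨R, hR⟩ := hc.isCompact.isBounded.exists_norm_le
  have outside (r φ : ℝ) (hr : 2 * R < r) : (r * Real.cos φ, r * Real.sin φ) ∉ tsupport w := by
    intro hmem
    have hn := hR _ hmem
    rw [Prod.norm_def, sup_le_iff, Real.norm_eq_abs, Real.norm_eq_abs] at hn
    obtain ⟨h1, h2⟩ := hn
    have hR0 : 0 ≤ R := (abs_nonneg _).trans h1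
    have h1' := sq_le_sq' (abs_le.1 h1).1 (abs_le.1 h1).2
    have h2' := sq_le_sq' (abs_le.1 h2).1 (abs_le.1 h2).2
    have : r ^ 2 = (r * Real.cos φ) ^ 2 + (r * Real.sin φ) ^ 2 := by
      linear_combination -r ^ 2 * Real.sin_sq_add_cos_sq φ
    nlinarith
  have hw0 (r φ : ℝ) (hr : 2 * R < r) : w (r * Real.cos φ, r * Real.sin φ) = 0 :=
    image_eq_zero_of_notMem_tsupport (outside r φ hr)
  have hdw0 (r φ : ℝ) (hr : 2 * R < r) : fderiv ℝ w (r * Real.cos φ, r * Real.sin φ) = 0 :=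
    image_eq_zero_of_notMem_tsupport fun h => outside r φ hr (tsupport_fderiv_subset ℝ h)
  have hderiv (a b : ℝ → ℝ) (a' b' t : ℝ) (ha : HasDerivAt a a' t) (hb : HasDerivAt b b' t) :
      HasDerivAt (fun s => w (a s, b s)) (a' * wa (a t, b t) + b' * wb (a t, b t)) t := by
    have hd : HasFDerivAt w (fderiv ℝ w (a t, b t)) (a t, b t) :=
      (hw.differentiable (by simp) _).hasFDerivAt
    refine (hd.comp_hasDerivAt t (ha.prodMk hb)).congr_deriv ?_
    rw [show ((a', b') : ℝ × ℝ) = a' • (1, 0) + b' • (0, 1) by simp, map_add, map_smul, map_smul]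
    simp [hwa, hwb]
  set P : ℝ × ℝ → ℝ := fun p => p.1 ^ 2 * ((wa (p.1 * Real.cos p.2, p.1 * Real.sin p.2)) ^ 2 +
    (wb (p.1 * Real.cos p.2, p.1 * Real.sin p.2)) ^ 2) * Real.sin p.2 with hP
  set Q : ℝ × ℝ → ℝ := fun p => ((-(p.1 * Real.sin p.2) *
    wa (p.1 * Real.cos p.2, p.1 * Real.sin p.2) + p.1 * Real.cos p.2 *
    wb (p.1 * Real.cos p.2, p.1 * Real.sin p.2)) ^ 2 +
    (1 / 4) * (w (p.1 * Real.cos p.2, p.1 * Real.sin p.2)) ^ 2) * Real.sin p.2 with hQ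
  have hPi : IntegrableOn P ((Ioi 0 : Set ℝ) ×ˢ Ioo 0 π) :=
    integrableOn_polar_strip (R := 2 * R) (by fun_prop)
      fun p hp => by simp [hP, hwa, hwb, hdw0 p.1 p.2 hp]
  have hQi : IntegrableOn Q ((Ioi 0 : Set ℝ) ×ˢ Ioo 0 π) :=
    integrableOn_polar_strip (R := 2 * R) (by fun_prop)
      fun p hp => by simp [hQ, hwa, hwb, hdw0 p.1 p.2 hp, hw0 p.1 p.2 hp]
  have left_polar : EqOn (fun p : ℝ × ℝ => p.1 * (fun p : ℝ × ℝ =>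
      q (p.2 / √(p.1 ^ 2 + p.2 ^ 2)) * (w p) ^ 2 / √(p.1 ^ 2 + p.2 ^ 2)) (polarCoord.symm p))
      (fun p => (w (p.1 * Real.cos p.2, p.1 * Real.sin p.2)) ^ 2 * q (Real.sin p.2))
      ((Ioi 0 : Set ℝ) ×ˢ Ioo 0 π) := by
    rintro ⟨r, φ⟩ ⟨hr, -⟩
    have hr : 0 < r := hr
    have hroot : √((r * Real.cos φ) ^ 2 + (r * Real.sin φ) ^ 2) = r := by
      rw [show (r * Real.cos φ) ^ 2 + (r * Real.sin φ) ^ 2 = r ^ 2 by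
        linear_combination r ^ 2 * Real.sin_sq_add_cos_sq φ, Real.sqrt_sq hr.le]
    simp only [polarCoord_symm_apply, hroot]
    rw [mul_div_cancel_left₀ _ hr.ne']
    field_simp
  have hLi := (integrableOn_polar_of_upper h_fin).congr_fun left_polar hS
  have angular : lamQ q * (∫ p in (Ioi 0 : Set ℝ) ×ˢ Ioo 0 π,
      (w (p.1 * Real.cos p.2, p.1 * Real.sin p.2)) ^ 2 * q (Real.sin p.2)) ≤
      ∫ p in (Ioi 0 : Set ℝ) ×ˢ Ioo 0 π, Q p := by
    rw [Measure.volume_eq_prod] at hLi hQi ⊢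
    rw [setIntegral_prod _ hLi, setIntegral_prod _ hQi, ← integral_const_mul]
    rw [IntegrableOn, ← Measure.prod_restrict] at hLi hQi
    refine integral_mono (hLi.integral_prod_left.const_mul _) hQi.integral_prod_left fun r => ?_
    refine (lamQ_mul_le_half q (fun φ => w (r * Real.cos φ, r * Real.sin φ))
      (hw.comp (by fun_prop))).trans_eq ?_
    congr 1 with φ
    have := (hderiv _ _ _ _ φ ((Real.hasDerivAt_cos φ).const_mul r)
      ((Real.hasDerivAt_sin φ).const_mul r)).deriv
    simp only [this, hQ]
    ring
  have radial : 0 ≤ ∫ p in (Ioi 0 : Set ℝ) ×ˢ Ioo 0 π, (P p - Q p) := by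
    rw [Measure.volume_eq_prod] at hPi hQi ⊢
    rw [IntegrableOn, ← Measure.prod_restrict] at hPi hQi
    rw [← Measure.prod_restrict, integral_prod_symm (fun p => P p - Q p) (hPi.sub hQi)]
    refine setIntegral_nonneg measurableSet_Ioo fun φ hφ => ?_
    have hsin := Real.sin_nonneg_of_nonneg_of_le_pi hφ.1.le hφ.2.le
    refine (mul_nonneg hsin (hardy_Ioi (R := 2 * R)
      (fun r => hderiv (fun r => r * Real.cos φ) (fun r => r * Real.sin φ) _ _ r
        (hasDerivAt_mul_const _) (hasDerivAt_mul_const _)) (by fun_prop)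
      (fun r hr => hw0 r φ hr) fun r hr => by simp [hwa, hwb, hdw0 r φ hr])).trans_eq ?_
    rw [← integral_const_mul]
    congr 1 with r
    simp only [hP, hQ]
    linear_combination (r ^ 2 * Real.sin φ *
      ((wa (r * Real.cos φ, r * Real.sin φ)) ^ 2 + (wb (r * Real.cos φ, r * Real.sin φ)) ^ 2)) *
      Real.sin_sq_add_cos_sq φ
  rw [integral_sub hPi hQi] at radial
  rw [setIntegral_upper_eq_polar, setIntegral_upper_eq_polar, setIntegral_congr_fun hS left_polar]
  refine (angular.trans (sub_nonneg.mp radial)).trans_eq ?_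
  congr 1 with p
  simp only [hP, polarCoord_symm_apply]
  ring

/-- The point of `ℝ^(m+2)` with first coordinates `z` and last two coordinates `p`. -/
def appendPair {m : ℕ} (z : Fin m → ℝ) (p : ℝ × ℝ) : EuclideanSpace ℝ (Fin (m + 2)) :=
  WithLp.toLp 2 (Fin.snoc (Fin.snoc z p.1 : Fin (m + 1) → ℝ) p.2 : Fin (m + 2) → ℝ)

@[simp]
theorem appendPair_last {m : ℕ} (z : Fin m → ℝ) (p : ℝ × ℝ) :
    appendPair z p (Fin.last (m + 1)) = p.2 := by
  simp [appendPair]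

@[simp]
theorem appendPair_castSucc_last {m : ℕ} (z : Fin m → ℝ) (p : ℝ × ℝ) :
    appendPair z p (Fin.last m).castSucc = p.1 := by
  simp [appendPair]

@[simp]
theorem appendPair_castSucc_castSucc {m : ℕ} (z : Fin m → ℝ) (p : ℝ × ℝ) (i : Fin m) :
    appendPair z p i.castSucc.castSucc = z i := by
  simp [appendPair]

theorem appendPair_eq_add {m : ℕ} (z : Fin m → ℝ) (p : ℝ × ℝ) :
    appendPair z p = appendPair z 0 + (p.1 • EuclideanSpace.single (Fin.last m).castSucc 1 +
      p.2 • EuclideanSpace.single (Fin.last (m + 1)) 1) := by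
  ext i
  refine Fin.lastCases ?_ (fun j => Fin.lastCases ?_ (fun k => ?_) j) i
  · simp [(Fin.castSucc_ne_last _).symm]
  · simp [Fin.castSucc_ne_last]
  · simp [Fin.castSucc_ne_last]

theorem exists_measurableEquiv_appendPair (m : ℕ) :
    ∃ e : ((Fin m → ℝ) × (ℝ × ℝ)) ≃ᵐ EuclideanSpace ℝ (Fin (m + 2)),
      MeasurePreserving e ∧ ∀ z p, e (z, p) = appendPair z p := by
  let e₁ := MeasurableEquiv.piFinSuccAbove (fun _ : Fin (m + 2) => ℝ) (Fin.last (m + 1))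
  let e₂ := MeasurableEquiv.piFinSuccAbove (fun _ : Fin (m + 1) => ℝ) (Fin.last m)
  have h₁ : MeasurePreserving e₁ := volume_preserving_piFinSuccAbove _ _
  have h₂ : MeasurePreserving e₂ := volume_preserving_piFinSuccAbove _ _
  have hswap : MeasurePreserving
      (MeasurableEquiv.prodComm : (Fin m → ℝ) × (ℝ × ℝ) ≃ᵐ (ℝ × ℝ) × (Fin m → ℝ)) :=
    Measure.measurePreserving_swap
  have hprod : MeasurePreserving (MeasurableEquiv.prodCongr
      (MeasurableEquiv.prodComm : ℝ × ℝ ≃ᵐ ℝ × ℝ) (MeasurableEquiv.refl (Fin m → ℝ))) :=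
    Measure.measurePreserving_swap.prod (MeasurePreserving.id _)
  have hassoc : MeasurePreserving
      (MeasurableEquiv.prodAssoc : (ℝ × ℝ) × (Fin m → ℝ) ≃ᵐ ℝ × (ℝ × (Fin m → ℝ))) :=
    measurePreserving_prodAssoc _ _ _
  have hinner : MeasurePreserving (MeasurableEquiv.prodCongr (MeasurableEquiv.refl ℝ) e₂.symm) :=
    (MeasurePreserving.id _).prod (h₂.symm e₂)
  refine ⟨((((MeasurableEquiv.prodComm.trans (MeasurableEquiv.prodCongr MeasurableEquiv.prodComm
    (MeasurableEquiv.refl _))).trans MeasurableEquiv.prodAssoc).trans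
    (MeasurableEquiv.prodCongr (MeasurableEquiv.refl ℝ) e₂.symm)).trans e₁.symm).trans
    (MeasurableEquiv.toLp 2 _), ?_, ?_⟩
  · exact (PiLp.volume_preserving_toLp _).comp ((h₁.symm e₁).comp (hinner.comp
      (hassoc.comp (hprod.comp hswap))))
  · intro z p
    change WithLp.toLp 2 (Fin.insertNth (Fin.last (m + 1)) p.2
      (Fin.insertNth (Fin.last m) p.1 z : Fin (m + 1) → ℝ) : Fin (m + 2) → ℝ) = _
    simp only [Fin.insertNth_last', appendPair]

open Set in
theorem weighted_hardy_add_two (m : ℕ) (q : ℝ → ℝ)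
    (u : EuclideanSpace ℝ (Fin (m + 2)) → ℝ) (hu : ContDiff ℝ (⊤ : ℕ∞) u)
    (hc : HasCompactSupport u) :
    lamQ q * ∫ x in {x : EuclideanSpace ℝ (Fin (m + 2)) | 0 < x (Fin.last (m + 1))},
        q (x (Fin.last (m + 1)) /
            √((x (Fin.last m).castSucc) ^ 2 + (x (Fin.last (m + 1))) ^ 2)) * (u x) ^ 2 /
          √((x (Fin.last m).castSucc) ^ 2 + (x (Fin.last (m + 1))) ^ 2) ≤
      ∫ x in {x : EuclideanSpace ℝ (Fin (m + 2)) | 0 < x (Fin.last (m + 1))},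
        x (Fin.last (m + 1)) * ∑ i, (pdn i u x) ^ 2 := by
  set H : Set (EuclideanSpace ℝ (Fin (m + 2))) := {x | 0 < x (Fin.last (m + 1))} with hH
  set U : Set (ℝ × ℝ) := {p | 0 < p.2} with hU
  have hHm : MeasurableSet H := measurableSet_lt measurable_const (by fun_prop)
  set f : EuclideanSpace ℝ (Fin (m + 2)) → ℝ := fun x => q (x (Fin.last (m + 1)) /
      √((x (Fin.last m).castSucc) ^ 2 + (x (Fin.last (m + 1))) ^ 2)) * (u x) ^ 2 /
    √((x (Fin.last m).castSucc) ^ 2 + (x (Fin.last (m + 1))) ^ 2) with hf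
  have full_nonneg : ∀ x ∈ H, 0 ≤ x (Fin.last (m + 1)) * ∑ i, (pdn i u x) ^ 2 :=
    fun x hx => mul_nonneg (le_of_lt hx) (Finset.sum_nonneg fun i _ => sq_nonneg _)
  by_cases h_fin : IntegrableOn f H
  swap
  · rw [integral_undef h_fin, mul_zero]
    exact setIntegral_nonneg hHm full_nonneg
  have hpc (i : Fin (m + 2)) : Continuous (pdn i u) :=
    (hu.continuous_fderiv (by simp)).clm_apply continuous_const
  have hps (i : Fin (m + 2)) : HasCompactSupport (pdn i u) := hc.fderiv_apply ℝ _
  set g : EuclideanSpace ℝ (Fin (m + 2)) → ℝ := fun x => x (Fin.last (m + 1)) *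
    ((pdn (Fin.last m).castSucc u x) ^ 2 + (pdn (Fin.last (m + 1)) u x) ^ 2) with hg
  have energy_integrable (i : Fin (m + 2)) :
      Integrable fun x => x (Fin.last (m + 1)) * (pdn i u x) ^ 2 := by
    refine Continuous.integrable_of_hasCompactSupport (by fun_prop) ?_
    refine (hps i).mono' ((Function.support_subset_iff'.2 fun x hx => ?_).trans subset_closure)
    simp [Function.notMem_support.1 hx]
  have hgi : Integrable g := by
    simpa only [hg, mul_add] using! (energy_integrable _).add (energy_integrable _)
  have hle : ∫ x in H, g x ≤ ∫ x in H, x (Fin.last (m + 1)) * ∑ i, (pdn i u x) ^ 2 := by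
    refine setIntegral_mono_on hgi.integrableOn ?_ hHm fun x hx => ?_
    · simp only [Finset.mul_sum]
      exact (integrable_finsetSum _ fun i _ => energy_integrable i).integrableOn
    · refine mul_le_mul_of_nonneg_left ?_ (le_of_lt hx)
      rw [Fin.sum_univ_castSucc, Fin.sum_univ_castSucc]
      have : 0 ≤ ∑ i : Fin m, (pdn i.castSucc.castSucc u x) ^ 2 :=
        Finset.sum_nonneg fun i _ => sq_nonneg _
      linarith
  refine le_trans ?_ hle
  obtain ⟨e, he, hea⟩ := exists_measurableEquiv_appendPair m
  have hpre : e ⁻¹' H = univ ×ˢ U := by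
    ext ⟨z, p⟩
    simp [hH, hU, hea]
  have slices (k : EuclideanSpace ℝ (Fin (m + 2)) → ℝ) (hk : IntegrableOn k H) :
      Integrable (fun z => ∫ p in U, k (appendPair z p)) ∧
        ∫ x in H, k x = ∫ z, ∫ p in U, k (appendPair z p) := by
    have hk' : IntegrableOn (k ∘ e) (univ ×ˢ U) (volume.prod volume) := by
      rw [← hpre, ← Measure.volume_eq_prod]
      exact (he.integrableOn_comp_preimage e.measurableEmbedding).2 hk
    constructor
    · rw [IntegrableOn, ← Measure.prod_restrict, Measure.restrict_univ] at hk'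
      simpa only [Function.comp_apply, hea] using hk'.integral_prod_left
    · have := setIntegral_prod _ hk'
      rw [← Measure.volume_eq_prod, ← hpre] at this
      rw [← he.setIntegral_preimage_emb e.measurableEmbedding]
      simpa only [Function.comp_apply, hea, Measure.restrict_univ] using this
  obtain ⟨hfi, hfe⟩ := slices f h_fin
  obtain ⟨hgi', hge⟩ := slices g hgi.integrableOn
  rw [hfe, hge, ← integral_const_mul]
  refine integral_mono (hfi.const_mul _) hgi' fun z => ?_
  let A : ℝ × ℝ →L[ℝ] EuclideanSpace ℝ (Fin (m + 2)) :=
    (ContinuousLinearMap.fst ℝ ℝ ℝ).smulRight (EuclideanSpace.single (Fin.last m).castSucc 1) +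
      (ContinuousLinearMap.snd ℝ ℝ ℝ).smulRight (EuclideanSpace.single (Fin.last (m + 1)) 1)
  have happ : appendPair z = fun p => appendPair z 0 + A p :=
    funext fun p => appendPair_eq_add z p
  have haff (p : ℝ × ℝ) : HasFDerivAt (appendPair z) A p := by
    rw [happ]
    exact A.hasFDerivAt.const_add _
  have hsmooth : ContDiff ℝ (⊤ : ℕ∞) (appendPair z) := by
    rw [happ]
    exact contDiff_const.add A.contDiff
  have hfd (p : ℝ × ℝ) : fderiv ℝ (fun p => u (appendPair z p)) p =
      (fderiv ℝ u (appendPair z p)).comp A :=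
    ((hu.differentiable (by simp) _).hasFDerivAt.comp p (haff p)).fderiv
  have hsupp : HasCompactSupport fun p => u (appendPair z p) := by
    obtain ⟨R, hR⟩ := hc.isCompact.isBounded.exists_norm_le
    refine HasCompactSupport.intro (isCompact_closedBall (0 : ℝ × ℝ) R) fun p hp => ?_
    refine image_eq_zero_of_notMem_tsupport fun hmem => hp ?_
    have hn := hR _ hmem
    rw [mem_closedBall_zero_iff, Prod.norm_def, sup_le_iff]
    constructor
    · simpa using (PiLp.norm_apply_le (appendPair z p) (Fin.last m).castSucc).trans hn
    · simpa using (PiLp.norm_apply_le (appendPair z p) (Fin.last (m + 1))).trans hn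
  have key := weighted_hardy_half_plane q (fun p => u (appendPair z p)) (hu.comp hsmooth) hsupp
  simpa [hf, hg, hfd, A, pdn] using key

/-- The weighted Hardy-type inequality on the half-space `ℝⁿ₊` holds with the
variational constant `λ`. -/
theorem weighted_hardy_halfspace
    (n : ℕ) (hn : 2 ≤ n) (q : ℝ → ℝ)
    (hq0 : ∀ t ∈ Set.Ioo (0 : ℝ) 1, 0 ≤ q t)
    (hqloc : LocallyIntegrableOn q (Set.Ioo (0 : ℝ) 1))
    (u : EuclideanSpace ℝ (Fin n) → ℝ) (hu : ContDiff ℝ (⊤ : ℕ∞) u)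
    (hc : HasCompactSupport u) :
    lamQ q * ∫ x in {x : EuclideanSpace ℝ (Fin n) | 0 < x ⟨n - 1, by omega⟩},
        q (x ⟨n - 1, by omega⟩ /
            Real.sqrt ((x ⟨n - 2, by omega⟩) ^ 2 + (x ⟨n - 1, by omega⟩) ^ 2)) *
          (u x) ^ 2 /
          Real.sqrt ((x ⟨n - 2, by omega⟩) ^ 2 + (x ⟨n - 1, by omega⟩) ^ 2) ≤
      ∫ x in {x : EuclideanSpace ℝ (Fin n) | 0 < x ⟨n - 1, by omega⟩},
        x ⟨n - 1, by omega⟩ * ∑ i : Fin n, (pdn i u x) ^ 2 := by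
  obtain ⟨m, rfl⟩ := Nat.exists_eq_add_of_le' hn
  exact weighted_hardy_add_two m q u hu hc
end
end

section
/- There exists an absolute constant C > 0 such that for every n ≥ 2 and every v ∈ C_0^∞(ℝⁿ₊) the inequality ∫_{ℝⁿ₊} |∇v|² dx − (1/4) ∫_{ℝⁿ₊} |v|²/x_n² dx ≥ C · ∫_{ℝⁿ₊} |v|² / ( x_n² · (1 − log( x_n/(x_{n-1}² + x_n²)^{1/2} ))² ) dx holds. -/
open MeasureTheory
open scoped Real

noncomputable section

/-- The logarithmic weight `1 - log (y / √(s² + y²))` on the half-plane `y > 0`. -/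
def logWeight (s y : ℝ) : ℝ := 1 - Real.log y + 1 / 2 * Real.log (s ^ 2 + y ^ 2)

/-- The first component of the field `-∇φ/φ`, where
`φ = (y / √(s² + y²))^(1/2) * (logWeight s y)^(1/8)`. -/
def hardyFieldFst (s y : ℝ) : ℝ :=
  (1 / 2 - 1 / 8 / logWeight s y) * (s / (s ^ 2 + y ^ 2))

/-- The second component of the field `-∇φ/φ`, where
`φ = (y / √(s² + y²))^(1/2) * (logWeight s y)^(1/8)`. -/
def hardyFieldSnd (s y : ℝ) : ℝ :=
  (1 / 2 - 1 / 8 / logWeight s y) * (y / (s ^ 2 + y ^ 2) - 1 / y)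

lemma one_sub_log_div_sqrt_eq_logWeight (s : ℝ) {y : ℝ} (hy : 0 < y) :
    1 - Real.log (y / Real.sqrt (s ^ 2 + y ^ 2)) = logWeight s y := by
  have hr : 0 < s ^ 2 + y ^ 2 := by positivity
  rw [logWeight, Real.log_div hy.ne' (Real.sqrt_pos.2 hr).ne', Real.log_sqrt hr.le]
  ring

lemma one_le_logWeight (s : ℝ) {y : ℝ} (hy : 0 < y) : 1 ≤ logWeight s y := by
  have h : Real.log (y ^ 2) ≤ Real.log (s ^ 2 + y ^ 2) :=
    Real.log_le_log (by positivity) (by nlinarith [sq_nonneg s])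
  rw [Real.log_pow] at h
  push_cast at h
  rw [logWeight]
  linarith

lemma hasDerivAt_logWeight_fst (s : ℝ) {y : ℝ} (hy : 0 < y) :
    HasDerivAt (fun t => logWeight t y) (s / (s ^ 2 + y ^ 2)) s := by
  have hr : s ^ 2 + y ^ 2 ≠ 0 := by positivity
  have h := (((hasDerivAt_pow 2 s).add_const (y ^ 2)).log hr).const_mul (1 / 2 : ℝ)
  refine (h.const_add (1 - Real.log y)).congr_deriv ?_
  field_simp
  norm_num

lemma hasDerivAt_logWeight_snd (s : ℝ) {y : ℝ} (hy : 0 < y) :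
    HasDerivAt (fun t => logWeight s t) (y / (s ^ 2 + y ^ 2) - 1 / y) y := by
  have hr : s ^ 2 + y ^ 2 ≠ 0 := by positivity
  have h := (((hasDerivAt_pow 2 y).const_add (s ^ 2)).log hr).const_mul (1 / 2 : ℝ)
  refine (((Real.hasDerivAt_log hy.ne').const_sub 1).add h).congr_deriv ?_
  field_simp
  norm_num
  ring

lemma hasDerivAt_hardyFieldFst (s : ℝ) {y : ℝ} (hy : 0 < y) :
    HasDerivAt (fun t => hardyFieldFst t y)
      (1 / 8 / logWeight s y ^ 2 * (s / (s ^ 2 + y ^ 2)) ^ 2 +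
        (1 / 2 - 1 / 8 / logWeight s y) * ((y ^ 2 - s ^ 2) / (s ^ 2 + y ^ 2) ^ 2)) s := by
  have hr : s ^ 2 + y ^ 2 ≠ 0 := by positivity
  have hL : logWeight s y ≠ 0 := by linarith [one_le_logWeight s hy]
  have h1 := (((hasDerivAt_const s (1 / 8 : ℝ)).div (hasDerivAt_logWeight_fst s hy) hL).const_sub
    (1 / 2 : ℝ)).mul
    ((hasDerivAt_id s).div (((hasDerivAt_id s).pow 2).add_const (y ^ 2)) hr)
  refine h1.congr_deriv ?_
  simp only [id, Pi.div_apply, Pi.pow_apply]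
  field_simp
  norm_num
  ring

lemma hasDerivAt_hardyFieldSnd (s : ℝ) {y : ℝ} (hy : 0 < y) :
    HasDerivAt (fun t => hardyFieldSnd s t)
      (1 / 8 / logWeight s y ^ 2 * (y / (s ^ 2 + y ^ 2) - 1 / y) ^ 2 +
        (1 / 2 - 1 / 8 / logWeight s y) *
          ((s ^ 2 - y ^ 2) / (s ^ 2 + y ^ 2) ^ 2 + 1 / y ^ 2)) y := by
  have hr : s ^ 2 + y ^ 2 ≠ 0 := by positivity
  have hL : logWeight s y ≠ 0 := by linarith [one_le_logWeight s hy]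
  have h1 := (((hasDerivAt_const y (1 / 8 : ℝ)).div (hasDerivAt_logWeight_snd s hy) hL).const_sub
    (1 / 2 : ℝ)).mul
    (((hasDerivAt_id y).div (((hasDerivAt_id y).pow 2).const_add (s ^ 2)) hr).sub
      ((hasDerivAt_const y (1 : ℝ)).div (hasDerivAt_id y) hy.ne'))
  refine h1.congr_deriv ?_
  simp only [id, Pi.div_apply, Pi.pow_apply, Pi.sub_apply]
  field_simp
  norm_num
  ring

/-- The Riccati inequality `div F - |F|² ≥ 1/(4y²) + c/(y² L²)` for the field
`F = (hardyFieldFst, hardyFieldSnd)` and `L = logWeight`. -/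
lemma hardyField_riccati (s : ℝ) {y : ℝ} (hy : 0 < y) :
    1 / 4 / y ^ 2 + 7 / 64 / (y ^ 2 * logWeight s y ^ 2) ≤
      deriv (fun t => hardyFieldFst t y) s + deriv (fun t => hardyFieldSnd s t) y -
        (hardyFieldFst s y ^ 2 + hardyFieldSnd s y ^ 2) := by
  rw [(hasDerivAt_hardyFieldFst s hy).deriv, (hasDerivAt_hardyFieldSnd s hy).deriv,
    hardyFieldFst, hardyFieldSnd]
  have hr : 0 < s ^ 2 + y ^ 2 := by positivity
  have hL := one_le_logWeight s hy
  generalize logWeight s y = L at *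
  have hL0 : 0 < L := by linarith
  have key : (1 / 4 - 1 / 8 / L - 7 / 64 / L ^ 2) / (s ^ 2 + y ^ 2) ≥ 0 := by
    have e : 1 / 4 - 1 / 8 / L - 7 / 64 / L ^ 2 = (1 / 4 * L ^ 2 - 1 / 8 * L - 7 / 64) / L ^ 2 := by
      field_simp
    rw [e]
    have : 0 ≤ 1 / 4 * L ^ 2 - 1 / 8 * L - 7 / 64 := by nlinarith
    positivity
  rw [← sub_nonneg]
  refine key.le.trans_eq ?_
  field_simp
  ring

section Coordinates

variable {n : ℕ} {i j : Fin n} {x : EuclideanSpace ℝ (Fin n)}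

lemma contDiffAt_logWeight (hx : 0 < x j) :
    ContDiffAt ℝ 1 (fun z : EuclideanSpace ℝ (Fin n) => logWeight (z i) (z j)) x := by
  have hr : x i ^ 2 + x j ^ 2 ≠ 0 := by positivity
  unfold logWeight
  have := hx.ne'
  fun_prop (disch := assumption)

lemma contDiffAt_hardyFieldFst (hx : 0 < x j) :
    ContDiffAt ℝ 1 (fun z : EuclideanSpace ℝ (Fin n) => hardyFieldFst (z i) (z j)) x := by
  have hr : x i ^ 2 + x j ^ 2 ≠ 0 := by positivity
  have hL : logWeight (x i) (x j) ≠ 0 := by linarith [one_le_logWeight (x i) hx]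
  have h := contDiffAt_logWeight (i := i) hx
  unfold hardyFieldFst
  fun_prop (disch := assumption)

lemma contDiffAt_hardyFieldSnd (hx : 0 < x j) :
    ContDiffAt ℝ 1 (fun z : EuclideanSpace ℝ (Fin n) => hardyFieldSnd (z i) (z j)) x := by
  have hr : x i ^ 2 + x j ^ 2 ≠ 0 := by positivity
  have hL : logWeight (x i) (x j) ≠ 0 := by linarith [one_le_logWeight (x i) hx]
  have h := contDiffAt_logWeight (i := i) hx
  have := hx.ne'
  unfold hardyFieldSnd
  fun_prop (disch := assumption)

lemma pdn_fst_eq_deriv (hij : i ≠ j) {G : ℝ → ℝ → ℝ}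
    (hG : DifferentiableAt ℝ (fun z : EuclideanSpace ℝ (Fin n) => G (z i) (z j)) x) :
    pdn i (fun z => G (z i) (z j)) x = deriv (fun t => G t (x j)) (x i) := by
  rw [pdn, ← hG.lineDeriv_eq_fderiv, lineDeriv]
  have := deriv_comp_const_add (f := fun t => G t (x j)) (x i) 0
  simpa [hij, hij.symm] using this

lemma pdn_snd_eq_deriv (hij : i ≠ j) {G : ℝ → ℝ → ℝ}
    (hG : DifferentiableAt ℝ (fun z : EuclideanSpace ℝ (Fin n) => G (z i) (z j)) x) :
    pdn j (fun z => G (z i) (z j)) x = deriv (fun t => G (x i) t) (x j) := by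
  rw [pdn, ← hG.lineDeriv_eq_fderiv, lineDeriv]
  have := deriv_comp_const_add (f := fun t => G (x i) t) (x j) 0
  simpa [hij, hij.symm] using this

end Coordinates

section TestFunctions

variable {n : ℕ} {v : EuclideanSpace ℝ (Fin n) → ℝ}

lemma tsupport_sq_subset (v : EuclideanSpace ℝ (Fin n) → ℝ) :
    tsupport (fun x => v x ^ 2) ⊆ tsupport v := by
  simpa only [sq] using tsupport_mul_subset_left (f := v) (g := v)

lemma hasCompactSupport_sq (hc : HasCompactSupport v) :
    HasCompactSupport fun x => v x ^ 2 :=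
  hc.of_isClosed_subset isClosed_closure (tsupport_sq_subset v)

lemma integrable_mul_of_continuousAt_tsupport {f g : EuclideanSpace ℝ (Fin n) → ℝ}
    (hf : Continuous f) (hc : HasCompactSupport f) (hg : ∀ x ∈ tsupport f, ContinuousAt g x) :
    Integrable (fun x => f x * g x) :=
  (continuous_of_tsupport fun x hx =>
    hf.continuousAt.mul (hg x (tsupport_mul_subset_left hx))).integrable_of_hasCompactSupport
      hc.mul_right

lemma continuous_pdn (hv : ContDiff ℝ 1 v) (k : Fin n) : Continuous (pdn k v) :=
  (hv.continuous_fderiv one_ne_zero).clm_apply continuous_const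

lemma hasCompactSupport_pdn (hc : HasCompactSupport v) (k : Fin n) :
    HasCompactSupport (pdn k v) :=
  hc.fderiv_apply ℝ _

lemma pdn_sq (hv : ContDiff ℝ 1 v) (k : Fin n) (x : EuclideanSpace ℝ (Fin n)) :
    pdn k (fun z => v z ^ 2) x = 2 * v x * pdn k v x := by
  have h := ((hv.differentiable one_ne_zero x).hasFDerivAt.pow 2).fderiv
  rw [pdn, h]
  simp [pdn]

lemma integrable_sq_mul_pdn_add (hv : ContDiff ℝ 1 v) (hc : HasCompactSupport v)
    {F : EuclideanSpace ℝ (Fin n) → ℝ} (hF : ∀ x ∈ tsupport v, ContDiffAt ℝ 1 F x) (k : Fin n) :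
    Integrable (fun x => v x ^ 2 * pdn k F x + 2 * v x * pdn k v x * F x) ∧
      ∫ x, (v x ^ 2 * pdn k F x + 2 * v x * pdn k v x * F x) = 0 := by
  have hsq := hasCompactSupport_sq hc
  have hts := tsupport_sq_subset v
  have hv2 : ContDiff ℝ 1 fun x => v x ^ 2 := hv.pow 2
  have h1 : Integrable fun x => v x ^ 2 * pdn k F x :=
    integrable_mul_of_continuousAt_tsupport hv2.continuous hsq fun x hx =>
      ((hF x (hts hx)).continuousAt_fderiv one_ne_zero).clm_apply continuousAt_const
  have h2 : Integrable fun x => pdn k (fun z => v z ^ 2) x * F x :=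
    integrable_mul_of_continuousAt_tsupport (continuous_pdn hv2 k) (hasCompactSupport_pdn hsq k)
      fun x hx => (hF x (hts (tsupport_fderiv_apply_subset ℝ _ hx))).continuousAt
  have h3 : Integrable fun x => v x ^ 2 * F x :=
    integrable_mul_of_continuousAt_tsupport hv2.continuous hsq fun x hx =>
      (hF x (hts hx)).continuousAt
  have h := integral_mul_fderiv_eq_neg_fderiv_mul_of_integrable h2 h1 h3
    (fun x _ => hv2.differentiable one_ne_zero x)
    (fun x hx => (hF x (hts hx)).differentiableAt one_ne_zero)
  simp only [← pdn_sq hv]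
  refine ⟨h1.add h2, ?_⟩
  rw [integral_add h1 h2]
  exact add_eq_zero_iff_eq_neg.2 h

end TestFunctions

/-- Hardy's inequality on the half-space with a logarithmically weighted remainder term:
there is an absolute constant `C > 0` such that for all dimensions `n ≥ 2` and all test
functions compactly supported in the open half-space,
`∫ |∇v|² − (1/4) ∫ |v|²/xₙ² ≥ C ∫ |v|² / (xₙ² (1 − log(xₙ/√(xₙ₋₁² + xₙ²)))²)`. -/
theorem hardy_inequality_log_remainder :
    ∃ C : ℝ, 0 < C ∧
      ∀ (n : ℕ) (hn : 2 ≤ n) (v : EuclideanSpace ℝ (Fin n) → ℝ),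
        ContDiff ℝ (⊤ : ℕ∞) v → HasCompactSupport v →
        tsupport v ⊆ {x : EuclideanSpace ℝ (Fin n) | 0 < x ⟨n - 1, by omega⟩} →
        (∫ x in {x : EuclideanSpace ℝ (Fin n) | 0 < x ⟨n - 1, by omega⟩},
            ∑ i : Fin n, (pdn i v x) ^ 2) -
          (1 / 4) * ∫ x in {x : EuclideanSpace ℝ (Fin n) | 0 < x ⟨n - 1, by omega⟩},
            (v x) ^ 2 / (x ⟨n - 1, by omega⟩) ^ 2 ≥
        C * ∫ x in {x : EuclideanSpace ℝ (Fin n) | 0 < x ⟨n - 1, by omega⟩},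
            (v x) ^ 2 /
              ((x ⟨n - 1, by omega⟩) ^ 2 *
                (1 - Real.log (x ⟨n - 1, by omega⟩ /
                  Real.sqrt ((x ⟨n - 2, by omega⟩) ^ 2 + (x ⟨n - 1, by omega⟩) ^ 2))) ^ 2) := by
  refine ⟨7 / 64, by norm_num, ?_⟩
  intro n hn v hv' hc hsupp
  have hv : ContDiff ℝ 1 v := hv'.of_le (by exact_mod_cast le_top)
  have hij : (⟨n - 2, by omega⟩ : Fin n) ≠ ⟨n - 1, by omega⟩ := by
    simp only [ne_eq, Fin.mk.injEq]
    omega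
  generalize (⟨n - 1, by omega⟩ : Fin n) = j at *
  generalize (⟨n - 2, by omega⟩ : Fin n) = i at *
  have hpos : ∀ x ∈ tsupport v, 0 < x j := fun x hx => hsupp hx
  have hzero : ∀ x, ¬ 0 < x j → v x = 0 := fun x hx =>
    image_eq_zero_of_notMem_tsupport fun h => hx (hpos x h)
  have hdzero : ∀ k x, ¬ 0 < x j → pdn k v x = 0 := fun k x hx =>
    image_eq_zero_of_notMem_tsupport fun h => hx (hpos x (tsupport_fderiv_apply_subset ℝ _ h))
  have hmeas : MeasurableSet {x : EuclideanSpace ℝ (Fin n) | 0 < x j} :=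
    (isOpen_lt continuous_const (by fun_prop)).measurableSet
  have hweight : ∫ x in {x : EuclideanSpace ℝ (Fin n) | 0 < x j},
      (v x) ^ 2 / ((x j) ^ 2 * (1 - Real.log (x j / Real.sqrt ((x i) ^ 2 + (x j) ^ 2))) ^ 2) =
      ∫ x in {x : EuclideanSpace ℝ (Fin n) | 0 < x j},
        (v x) ^ 2 / ((x j) ^ 2 * logWeight (x i) (x j) ^ 2) :=
    setIntegral_congr_fun hmeas fun x hx => by
      simp only [one_sub_log_div_sqrt_eq_logWeight (x i) hx]
  rw [hweight, setIntegral_eq_integral_of_forall_compl_eq_zero (fun x hx => by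
      simp [hdzero _ x hx]),
    setIntegral_eq_integral_of_forall_compl_eq_zero (fun x hx => by simp [hzero x hx]),
    setIntegral_eq_integral_of_forall_compl_eq_zero (fun x hx => by simp [hzero x hx])]
  have hsq := hasCompactSupport_sq hc
  have hts := tsupport_sq_subset v
  have hgrad : Integrable fun x => ∑ k : Fin n, (pdn k v x) ^ 2 :=
    integrable_finsetSum _ fun k _ =>
      ((continuous_pdn hv k).pow 2).integrable_of_hasCompactSupport
        (hasCompactSupport_sq (hasCompactSupport_pdn hc k))
  have hhardy : Integrable fun x => (v x) ^ 2 / (x j) ^ 2 := by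
    simp only [div_eq_mul_inv]
    refine integrable_mul_of_continuousAt_tsupport (hv.continuous.pow 2) hsq fun x hx => ?_
    have : x j ^ 2 ≠ 0 := (pow_pos (hpos x (hts hx)) 2).ne'
    fun_prop (disch := assumption)
  have hrem : Integrable fun x => (v x) ^ 2 / ((x j) ^ 2 * logWeight (x i) (x j) ^ 2) := by
    simp only [div_eq_mul_inv]
    refine integrable_mul_of_continuousAt_tsupport (hv.continuous.pow 2) hsq fun x hx => ?_
    have hx := hpos x (hts hx)
    have hL := one_le_logWeight (x i) hx
    have : x j ^ 2 * logWeight (x i) (x j) ^ 2 ≠ 0 := by positivity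
    have := (contDiffAt_logWeight (i := i) hx).continuousAt
    fun_prop (disch := assumption)
  obtain ⟨hI1, h1⟩ := integrable_sq_mul_pdn_add hv hc
    (fun x hx => contDiffAt_hardyFieldFst (i := i) (hpos x hx)) i
  obtain ⟨hI2, h2⟩ := integrable_sq_mul_pdn_add hv hc
    (fun x hx => contDiffAt_hardyFieldSnd (i := i) (hpos x hx)) j
  have hmono := integral_mono ((hhardy.const_mul (1 / 4)).add (hrem.const_mul (7 / 64)))
    ((hgrad.add hI1).add hI2) (fun x => by
      simp only [Pi.add_apply]
      by_cases hx : 0 < x j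
      · rw [pdn_fst_eq_deriv hij ((contDiffAt_hardyFieldFst hx).differentiableAt one_ne_zero),
          pdn_snd_eq_deriv hij ((contDiffAt_hardyFieldSnd hx).differentiableAt one_ne_zero)]
        have hsum : pdn i v x ^ 2 + pdn j v x ^ 2 ≤ ∑ k : Fin n, pdn k v x ^ 2 := by
          rw [← Finset.sum_pair (f := fun k => pdn k v x ^ 2) hij]
          exact Finset.sum_le_sum_of_subset_of_nonneg (Finset.subset_univ _)
            fun _ _ _ => sq_nonneg _
        have hric := mul_le_mul_of_nonneg_left (hardyField_riccati (x i) hx) (sq_nonneg (v x))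
        have e : v x ^ 2 * (1 / 4 / x j ^ 2 + 7 / 64 / (x j ^ 2 * logWeight (x i) (x j) ^ 2)) =
            1 / 4 * (v x ^ 2 / x j ^ 2) +
              7 / 64 * (v x ^ 2 / (x j ^ 2 * logWeight (x i) (x j) ^ 2)) := by ring
        rw [e] at hric
        nlinarith [sq_nonneg (pdn i v x + v x * hardyFieldFst (x i) (x j)),
          sq_nonneg (pdn j v x + v x * hardyFieldSnd (x i) (x j))]
      · simp [hzero x hx, hdzero _ x hx])
  rw [integral_add' (hhardy.const_mul _) (hrem.const_mul _), integral_const_mul,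
    integral_const_mul, integral_add' (hgrad.add hI1) hI2, integral_add' hgrad hI1, h1, h2]
    at hmono
  linarith
end
end

section
/- For every u ∈ C_0^∞(ℝ²) the inequality ∫_{ℝ²} x₂² |u(x)|² / ( (x₁² + x₂²) · ( π²/4 − ( arcsin( x₁/(x₁² + x₂²)^{1/2} ) )² ) ) dx ≤ (1/2) ∫_{ℝ²} x₂² |∇u(x)|² dx holds, and the constant 1/2 is best possible. -/
open MeasureTheory
open scoped Real

noncomputable section

/-- Partial derivative of a real-valued function on `ℝ²` in the `i`-th coordinate
direction. -/
def pdR (i : Fin 2) (u : E2 → ℝ) (x : E2) : ℝ :=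
  fderiv ℝ u x (EuclideanSpace.single i 1)

/-- The continuous extension of `sin² θ / (|θ| (π - |θ|))` from `(-π, π)` to the real line. -/
def arcWeight (θ : ℝ) : ℝ := Real.sinc θ * Real.sinc (π - |θ|)

lemma continuous_arcWeight : Continuous arcWeight := by
  unfold arcWeight
  exact Real.continuous_sinc.mul (Real.continuous_sinc.comp (by fun_prop))

lemma arcWeight_neg (θ : ℝ) : arcWeight (-θ) = arcWeight θ := by
  simp [arcWeight, Real.sinc_neg]

lemma arcWeight_eq_of_mem {θ : ℝ} (hθ : θ ∈ Set.Icc 0 π) :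
    arcWeight θ = Real.sin θ ^ 2 / (θ * (π - θ)) := by
  obtain ⟨h0, hπ⟩ := hθ
  rw [arcWeight, abs_of_nonneg h0]
  rcases h0.eq_or_lt with rfl | h0
  · simp [Real.sinc_of_ne_zero Real.pi_ne_zero]
  rcases hπ.eq_or_lt with rfl | hπ
  · simp [Real.sinc_of_ne_zero Real.pi_ne_zero]
  rw [Real.sinc_of_ne_zero h0.ne', Real.sinc_of_ne_zero (sub_pos.2 hπ).ne', Real.sin_pi_sub]
  have := (sub_pos.2 hπ).ne'
  field_simp

lemma arcsin_cos_of_mem {θ : ℝ} (hθ : θ ∈ Set.Icc 0 π) :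
    Real.arcsin (Real.cos θ) = π / 2 - θ := by
  rw [← Real.sin_pi_div_two_sub, Real.arcsin_sin] <;> linarith [hθ.1, hθ.2]

lemma arcWeight_eq {θ : ℝ} (hθ : θ ∈ Set.Icc (-π) π) :
    arcWeight θ = Real.sin θ ^ 2 / (π ^ 2 / 4 - Real.arcsin (Real.cos θ) ^ 2) := by
  wlog h : 0 ≤ θ generalizing θ
  · have := this (θ := -θ) ⟨by linarith [hθ.2], by linarith [hθ.1]⟩ (by linarith)
    simpa [arcWeight_neg] using this
  rw [arcWeight_eq_of_mem ⟨h, hθ.2⟩, arcsin_cos_of_mem ⟨h, hθ.2⟩]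
  congr 1
  ring

lemma integral_symm_interval {f : ℝ → ℝ} (hf : Continuous f) (a : ℝ) :
    ∫ θ in -a..a, f θ = (∫ θ in 0..a, f θ) + ∫ θ in 0..a, f (-θ) := by
  rw [intervalIntegral.integral_comp_neg (fun θ => f θ), neg_zero, add_comm]
  exact (intervalIntegral.integral_add_adjacent_intervals
    (hf.intervalIntegrable _ _) (hf.intervalIntegrable _ _)).symm

/-- One-dimensional Hardy inequality with the weight `sin²` on half a period. -/
lemma angular_hardy_half {h h' : ℝ → ℝ} (hd : ∀ θ, HasDerivAt h (h' θ) θ) (hc : Continuous h') :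
    2 * ∫ θ in 0..π, arcWeight θ * h θ ^ 2 ≤
      ∫ θ in 0..π, Real.sin θ ^ 2 * (h' θ ^ 2 + h θ ^ 2) := by
  have hh : Continuous h := continuous_iff_continuousAt.2 fun θ => (hd θ).continuousAt
  have hW := continuous_arcWeight
  let q : ℝ → ℝ := fun θ => arcWeight θ * (π - 2 * θ) - Real.sin θ * Real.cos θ
  have hq : Continuous q := by fun_prop
  have hWi : Continuous fun θ => arcWeight θ * h θ ^ 2 := by fun_prop
  have hEi : Continuous fun θ => Real.sin θ ^ 2 * (h' θ ^ 2 + h θ ^ 2) := by fun_prop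
  have hφ : Continuous fun θ =>
      Real.sin θ ^ 2 * (h' θ ^ 2 + h θ ^ 2) - 2 * (arcWeight θ * h θ ^ 2) := by fun_prop
  have key := intervalIntegral.sub_le_integral_of_hasDeriv_right_of_le (a := 0) (b := π)
    (g := fun θ => h θ ^ 2 * q θ)
    (g' := fun θ => 2 * h θ * h' θ * q θ + h θ ^ 2 *
      (((2 * Real.sin θ * Real.cos θ) * (θ * (π - θ)) - Real.sin θ ^ 2 * (π - 2 * θ)) /
        (θ * (π - θ)) ^ 2 * (π - 2 * θ) + Real.sin θ ^ 2 / (θ * (π - θ)) * (-2) -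
        (Real.cos θ * Real.cos θ + Real.sin θ * (-Real.sin θ))))
    (φ := fun θ => Real.sin θ ^ 2 * (h' θ ^ 2 + h θ ^ 2) - 2 * (arcWeight θ * h θ ^ 2))
    Real.pi_pos.le (by fun_prop) ?_ (hφ.integrableOn_Icc) ?_
  · rw [intervalIntegral.integral_sub (hEi.intervalIntegrable _ _)
      ((hWi.const_mul 2).intervalIntegrable _ _), intervalIntegral.integral_const_mul] at key
    have h0 : q 0 = 0 := by simp [q, arcWeight_eq_of_mem ⟨le_rfl, Real.pi_pos.le⟩]
    have h1 : q π = 0 := by simp [q, arcWeight_eq_of_mem ⟨Real.pi_pos.le, le_rfl⟩]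
    simp only [h0, h1] at key
    linarith
  · intro θ hθ
    have hw : θ * (π - θ) ≠ 0 := (mul_pos hθ.1 (sub_pos.2 hθ.2)).ne'
    have hwd : HasDerivAt (fun θ : ℝ => θ * (π - θ)) (π - 2 * θ) θ := by
      have := (hasDerivAt_id θ).mul ((hasDerivAt_id θ).const_sub π)
      refine this.congr_deriv ?_
      simp; ring
    have hsd : HasDerivAt (fun θ : ℝ => Real.sin θ ^ 2) (2 * Real.sin θ * Real.cos θ) θ := by
      simpa using (Real.hasDerivAt_sin θ).fun_pow 2
    have hld : HasDerivAt (fun θ : ℝ => π - 2 * θ) (-2) θ := by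
      simpa using ((hasDerivAt_id θ).const_mul 2).const_sub π
    have hqd := (((hsd.div hwd hw).mul hld).sub
      ((Real.hasDerivAt_sin θ).mul (Real.hasDerivAt_cos θ)))
    have hqd' := hqd.congr_of_eventuallyEq (f₁ := q) (by
      filter_upwards [Ioo_mem_nhds hθ.1 hθ.2] with t ht
      simp [q, arcWeight_eq_of_mem ⟨ht.1.le, ht.2.le⟩])
    have := ((hd θ).pow 2).mul hqd'
    refine (this.congr_deriv ?_).hasDerivWithinAt
    simp [q, arcWeight_eq_of_mem ⟨hθ.1.le, hθ.2.le⟩]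
  · intro θ hθ
    have hs : Real.sin θ ≠ 0 := (Real.sin_pos_of_pos_of_lt_pi hθ.1 hθ.2).ne'
    have h1 : θ ≠ 0 := hθ.1.ne'
    have h2 : π - θ ≠ 0 := (sub_pos.2 hθ.2).ne'
    simp only [q, arcWeight_eq_of_mem ⟨hθ.1.le, hθ.2.le⟩]
    rw [← sub_nonneg]
    have e : ∀ S C : ℝ, S ≠ 0 → S ^ 2 * (h' θ ^ 2 + h θ ^ 2) -
        2 * (S ^ 2 / (θ * (π - θ)) * h θ ^ 2) -
        (2 * h θ * h' θ * (S ^ 2 / (θ * (π - θ)) * (π - 2 * θ) - S * C) +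
          h θ ^ 2 * ((2 * S * C * (θ * (π - θ)) - S ^ 2 * (π - 2 * θ)) /
            (θ * (π - θ)) ^ 2 * (π - 2 * θ) + S ^ 2 / (θ * (π - θ)) * (-2) -
            (C * C + S * -S))) =
        (S * h' θ - h θ * (S / (θ * (π - θ)) * (π - 2 * θ) - C)) ^ 2 := by
      intro S C hS
      field_simp
      ring
    rw [e _ _ hs]
    positivity

/-- Symmetric version over a full period. -/
lemma angular_hardy {h h' : ℝ → ℝ} (hd : ∀ θ, HasDerivAt h (h' θ) θ) (hc : Continuous h') :
    2 * ∫ θ in -π..π, arcWeight θ * h θ ^ 2 ≤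
      ∫ θ in -π..π, Real.sin θ ^ 2 * (h' θ ^ 2 + h θ ^ 2) := by
  have hh : Continuous h := continuous_iff_continuousAt.2 fun θ => (hd θ).continuousAt
  have hW := continuous_arcWeight
  rw [integral_symm_interval (by fun_prop), integral_symm_interval (by fun_prop)]
  have h1 := angular_hardy_half hd hc
  have h2 := angular_hardy_half (h := fun θ => h (-θ)) (h' := fun θ => -h' (-θ))
    (fun θ => by
      simpa [Function.comp_def] using (hd (-θ)).scomp θ (hasDerivAt_neg θ)) (by fun_prop)
  simp only [arcWeight_neg, Real.sin_neg, neg_sq] at h2 ⊢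
  linarith

/-- One-dimensional weighted Hardy inequality with constant one. -/
lemma radial_hardy {f f' : ℝ → ℝ} (hd : ∀ r, HasDerivAt f (f' r) r) (hc : Continuous f')
    {R : ℝ} (hR : 0 ≤ R) (hf : f R = 0) :
    ∫ r in 0..R, r * f r ^ 2 ≤ ∫ r in 0..R, r ^ 3 * f' r ^ 2 := by
  have hh : Continuous f := continuous_iff_continuousAt.2 fun r => (hd r).continuousAt
  have h1 : Continuous fun r => r * f r ^ 2 := by fun_prop
  have h2 : Continuous fun r => r ^ 3 * f' r ^ 2 := by fun_prop
  have key := intervalIntegral.sub_le_integral_of_hasDeriv_right_of_le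
    (g := fun r => -(r ^ 2 * f r ^ 2))
    (g' := fun r => -(2 * r * f r ^ 2 + r ^ 2 * (2 * f r * f' r)))
    (φ := fun r => r ^ 3 * f' r ^ 2 - r * f r ^ 2)
    hR (by fun_prop) (fun r _ => ?_) (h2.sub h1).integrableOn_Icc (fun r hr => ?_)
  · rw [intervalIntegral.integral_sub (h2.intervalIntegrable _ _) (h1.intervalIntegrable _ _)]
      at key
    simp [hf] at key
    linarith
  · have := (((hasDerivAt_id r).pow 2).mul ((hd r).pow 2)).neg
    refine (this.congr_deriv ?_).hasDerivWithinAt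
    simp
  · have : 0 ≤ r * (r * f' r + f r) ^ 2 := mul_nonneg hr.1.le (sq_nonneg _)
    linarith [show r ^ 3 * f' r ^ 2 - r * f r ^ 2 +
      (2 * r * f r ^ 2 + r ^ 2 * (2 * f r * f' r)) = r * (r * f' r + f r) ^ 2 by ring]

/-- The point of the plane with polar coordinates `(r, θ)`. -/
def polarPt (r θ : ℝ) : E2 := !₂[r * Real.cos θ, r * Real.sin θ]

@[simp] lemma polarPt_zero (r θ : ℝ) : polarPt r θ 0 = r * Real.cos θ := rfl

@[simp] lemma polarPt_one (r θ : ℝ) : polarPt r θ 1 = r * Real.sin θ := rfl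

lemma polarPt_sq_add_sq (r θ : ℝ) : polarPt r θ 0 ^ 2 + polarPt r θ 1 ^ 2 = r ^ 2 := by
  simp only [polarPt_zero, polarPt_one]
  linear_combination r ^ 2 * Real.sin_sq_add_cos_sq θ

lemma norm_polarPt (r θ : ℝ) : ‖polarPt r θ‖ = |r| := by
  rw [EuclideanSpace.norm_eq, Fin.sum_univ_two, Real.norm_eq_abs, Real.norm_eq_abs, sq_abs, sq_abs,
    polarPt_sq_add_sq, Real.sqrt_sq_eq_abs]

lemma polarPt_eq (r θ : ℝ) : polarPt r θ = (r * Real.cos θ) • EuclideanSpace.single 0 (1 : ℝ) +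
    (r * Real.sin θ) • EuclideanSpace.single 1 (1 : ℝ) := by
  ext i
  fin_cases i <;> simp

lemma continuous_polarPt : Continuous fun p : ℝ × ℝ => polarPt p.1 p.2 := by
  simp only [polarPt_eq]
  fun_prop

lemma integral_eq_integral_polar {f : E2 → ℝ} {G : ℝ × ℝ → ℝ} (hG : Continuous G) {R : ℝ}
    (hR : 0 ≤ R)
    (hfG : ∀ r > 0, ∀ θ ∈ Set.Icc (-π) π, r * f (polarPt r θ) = G (r, θ))
    (hz : ∀ r ≥ R, ∀ θ, G (r, θ) = 0) :
    ∫ x, f x = ∫ r in 0..R, ∫ θ in -π..π, G (r, θ) := by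
  have e1 : ∫ x, f x = ∫ p : ℝ × ℝ, f !₂[p.1, p.2] := by
    rw [← (PiLp.volume_preserving_toLp (Fin 2)).integral_comp
      (MeasurableEquiv.toLp 2 (Fin 2 → ℝ)).measurableEmbedding,
      ← (volume_preserving_finTwoArrow ℝ).symm.integral_comp
      (MeasurableEquiv.finTwoArrow (α := ℝ)).symm.measurableEmbedding]
    rfl
  rw [e1, ← integral_comp_polarCoord_symm]
  have e2 : ∫ p in polarCoord.target, p.1 • f !₂[(polarCoord.symm p).1, (polarCoord.symm p).2] =
      ∫ p in polarCoord.target, G p := by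
    refine setIntegral_congr_fun polarCoord.open_target.measurableSet fun p hp => ?_
    exact hfG p.1 hp.1 p.2 ⟨hp.2.1.le, hp.2.2.le⟩
  have e3 : ∫ p in polarCoord.target, G p = ∫ p in Set.Ioc 0 R ×ˢ Set.Ioc (-π) π, G p := by
    have : (Set.Ioi (0 : ℝ) ×ˢ Set.Ioo (-π) π : Set (ℝ × ℝ)) =ᵐ[volume]
        (Set.Ioi (0 : ℝ) ×ˢ Set.Ioc (-π) π : Set (ℝ × ℝ)) :=
      Measure.set_prod_ae_eq (Filter.EventuallyEq.rfl) Ioo_ae_eq_Ioc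
    rw [show polarCoord.target = (Set.Ioi (0 : ℝ) ×ˢ Set.Ioo (-π) π : Set (ℝ × ℝ)) from rfl,
      setIntegral_congr_set this]
    refine setIntegral_eq_of_subset_of_forall_sdiff_eq_zero
      (measurableSet_Ioi.prod measurableSet_Ioc)
      (Set.prod_mono Set.Ioc_subset_Ioi_self subset_rfl) ?_
    rintro ⟨r, θ⟩ ⟨⟨h1, h2⟩, h3⟩
    refine hz r ?_ θ
    by_contra! h
    exact h3 ⟨⟨h1, h.le⟩, h2⟩
  rw [e2, e3, Measure.volume_eq_prod, setIntegral_prod, intervalIntegral.integral_of_le hR]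
  · simp only [intervalIntegral.integral_of_le (by linarith [Real.pi_pos] : -π ≤ π)]
  · refine IntegrableOn.mono_set ?_
      (Set.prod_mono Set.Ioc_subset_Icc_self Set.Ioc_subset_Icc_self)
    exact hG.continuousOn.integrableOn_compact (isCompact_Icc.prod isCompact_Icc)

lemma integral_swap_of_continuous {F : ℝ → ℝ → ℝ} (hF : Continuous fun p : ℝ × ℝ => F p.1 p.2)
    {a b c d : ℝ} :
    ∫ x in a..b, ∫ y in c..d, F x y = ∫ y in c..d, ∫ x in a..b, F x y := by
  refine intervalIntegral_intervalIntegral_swap (IntegrableOn.mono_set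
    (hF.continuousOn.integrableOn_compact (isCompact_uIcc.prod isCompact_uIcc))
    (Set.prod_mono Set.uIoc_subset_uIcc Set.uIoc_subset_uIcc))

lemma continuous_inner_integral {F : ℝ → ℝ → ℝ} (hF : Continuous fun p : ℝ × ℝ => F p.1 p.2)
    (c d : ℝ) : Continuous fun x => ∫ y in c..d, F x y :=
  intervalIntegral.continuous_parametric_intervalIntegral_of_continuous' hF _ _

lemma integral_integral_mono {F G : ℝ → ℝ → ℝ} (hF : Continuous fun p : ℝ × ℝ => F p.1 p.2)
    (hG : Continuous fun p : ℝ × ℝ => G p.1 p.2) {a b c d : ℝ} (hab : a ≤ b)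
    (h : ∀ x ∈ Set.Icc a b, ∫ y in c..d, F x y ≤ ∫ y in c..d, G x y) :
    ∫ x in a..b, ∫ y in c..d, F x y ≤ ∫ x in a..b, ∫ y in c..d, G x y :=
  intervalIntegral.integral_mono_on hab ((continuous_inner_integral hF c d).intervalIntegrable _ _)
    ((continuous_inner_integral hG c d).intervalIntegrable _ _) h

lemma integral_integral_add {F G : ℝ → ℝ → ℝ} (hF : Continuous fun p : ℝ × ℝ => F p.1 p.2)
    (hG : Continuous fun p : ℝ × ℝ => G p.1 p.2) {a b c d : ℝ} :
    ∫ x in a..b, ∫ y in c..d, (F x y + G x y) =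
      (∫ x in a..b, ∫ y in c..d, F x y) + ∫ x in a..b, ∫ y in c..d, G x y := by
  rw [← intervalIntegral.integral_add ((continuous_inner_integral hF c d).intervalIntegrable _ _)
    ((continuous_inner_integral hG c d).intervalIntegrable _ _)]
  congr 1
  ext x
  exact intervalIntegral.integral_add
    ((hF.comp (Continuous.prodMk_right x)).intervalIntegrable _ _)
    ((hG.comp (Continuous.prodMk_right x)).intervalIntegrable _ _)

/-- The arcsine Hardy integrand. -/
def hardyDensity (u : E2 → ℝ) (x : E2) : ℝ :=
  (x 1) ^ 2 * (u x) ^ 2 /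
    (((x 0) ^ 2 + (x 1) ^ 2) *
      (π ^ 2 / 4 - (Real.arcsin (x 0 / Real.sqrt ((x 0) ^ 2 + (x 1) ^ 2))) ^ 2))

/-- The weighted energy integrand. -/
def energyDensity (u : E2 → ℝ) (x : E2) : ℝ :=
  (x 1) ^ 2 * ((pdR 0 u x) ^ 2 + (pdR 1 u x) ^ 2)

lemma hardyDensity_polar (u : E2 → ℝ) {r θ : ℝ} (hr : 0 < r) (hθ : θ ∈ Set.Icc (-π) π) :
    r * hardyDensity u (polarPt r θ) = r * (arcWeight θ * u (polarPt r θ) ^ 2) := by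
  rw [hardyDensity, polarPt_sq_add_sq, Real.sqrt_sq hr.le, arcWeight_eq hθ, polarPt_zero,
    polarPt_one, mul_div_cancel_left₀ _ hr.ne', mul_pow, mul_assoc,
    mul_div_mul_left _ _ (by positivity), mul_comm (Real.sin θ ^ 2), mul_div_assoc]
  ring

/-- The radial derivative in polar coordinates. -/
def radialDeriv (u : E2 → ℝ) (r θ : ℝ) : ℝ :=
  Real.cos θ * pdR 0 u (polarPt r θ) + Real.sin θ * pdR 1 u (polarPt r θ)

/-- The angular derivative in polar coordinates. -/
def angularDeriv (u : E2 → ℝ) (r θ : ℝ) : ℝ :=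
  -(r * Real.sin θ) * pdR 0 u (polarPt r θ) + r * Real.cos θ * pdR 1 u (polarPt r θ)

lemma energyDensity_polar (u : E2 → ℝ) (r θ : ℝ) :
    r * energyDensity u (polarPt r θ) =
      Real.sin θ ^ 2 * (r ^ 3 * radialDeriv u r θ ^ 2) +
        r * (Real.sin θ ^ 2 * angularDeriv u r θ ^ 2) := by
  simp only [energyDensity, radialDeriv, angularDeriv, polarPt_one]
  linear_combination (-r ^ 3 * Real.sin θ ^ 2 *
    (pdR 0 u (polarPt r θ) ^ 2 + pdR 1 u (polarPt r θ) ^ 2)) * Real.sin_sq_add_cos_sq θ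

lemma fderiv_polar {u : E2 → ℝ} (x : E2) (a b : ℝ) :
    fderiv ℝ u x (a • EuclideanSpace.single 0 (1 : ℝ) + b • EuclideanSpace.single 1 (1 : ℝ)) =
      a * pdR 0 u x + b * pdR 1 u x := by
  simp [pdR]

lemma hasDerivAt_radial {u : E2 → ℝ} (hu : Differentiable ℝ u) (r θ : ℝ) :
    HasDerivAt (fun r => u (polarPt r θ)) (radialDeriv u r θ) r := by
  have h1 : HasDerivAt (fun r => polarPt r θ)
      (Real.cos θ • EuclideanSpace.single 0 (1 : ℝ) +
        Real.sin θ • EuclideanSpace.single 1 (1 : ℝ)) r := by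
    simp only [polarPt_eq]
    exact ((hasDerivAt_mul_const _).smul_const _).add ((hasDerivAt_mul_const _).smul_const _)
  have := (hu (polarPt r θ)).hasFDerivAt.comp_hasDerivAt r h1
  rwa [fderiv_polar] at this

lemma hasDerivAt_angular {u : E2 → ℝ} (hu : Differentiable ℝ u) (r θ : ℝ) :
    HasDerivAt (fun θ => u (polarPt r θ)) (angularDeriv u r θ) θ := by
  have h1 : HasDerivAt (fun θ => polarPt r θ)
      ((-(r * Real.sin θ)) • EuclideanSpace.single 0 (1 : ℝ) +
        (r * Real.cos θ) • EuclideanSpace.single 1 (1 : ℝ)) θ := by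
    simp only [polarPt_eq]
    refine HasDerivAt.add (HasDerivAt.smul_const ?_ _) (HasDerivAt.smul_const ?_ _)
    · simpa using (Real.hasDerivAt_cos θ).const_mul r
    · exact (Real.hasDerivAt_sin θ).const_mul r
  have := (hu (polarPt r θ)).hasFDerivAt.comp_hasDerivAt θ h1
  rwa [fderiv_polar] at this

lemma hasCompactSupport_bound {u : E2 → ℝ} (hs : HasCompactSupport u) :
    ∃ R > 0, ∀ x : E2, R ≤ ‖x‖ → x ∉ tsupport u := by
  obtain ⟨R, hR, h⟩ := hs.isBounded.exists_pos_norm_lt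
  exact ⟨R, hR, fun x hx hxs => absurd (h x hxs) (not_lt.2 hx)⟩

lemma pdR_eq_zero {u : E2 → ℝ} {x : E2} (hx : x ∉ tsupport u) (i : Fin 2) : pdR i u x = 0 := by
  have : fderiv ℝ u x = 0 := by
    by_contra h
    exact hx (support_fderiv_subset ℝ h)
  simp [pdR, this]

lemma continuous_pdR {u : E2 → ℝ} (hu : ContDiff ℝ (⊤ : ℕ∞) u) (i : Fin 2) :
    Continuous (pdR i u) :=
  (hu.continuous_fderiv (by simp)).clm_apply continuous_const

lemma integral_hardyDensity_eq {u : E2 → ℝ} (hu : Continuous u) {R : ℝ} (hR : 0 ≤ R)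
    (hs : ∀ x : E2, R ≤ ‖x‖ → u x = 0) :
    ∫ x, hardyDensity u x =
      ∫ r in 0..R, ∫ θ in -π..π, r * (arcWeight θ * u (polarPt r θ) ^ 2) := by
  have hW := continuous_arcWeight
  have hp := continuous_polarPt
  refine integral_eq_integral_polar
    (G := fun p => p.1 * (arcWeight p.2 * u (polarPt p.1 p.2) ^ 2)) (by fun_prop) hR
    (fun r hr θ hθ => hardyDensity_polar u hr hθ) (fun r hr θ => ?_)
  simp [hs (polarPt r θ) (by rw [norm_polarPt]; exact hr.trans (le_abs_self r))]

theorem arcsin_hardy_inequality {u : E2 → ℝ} (hu : ContDiff ℝ (⊤ : ℕ∞) u)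
    (hs : HasCompactSupport u) :
    ∫ x, hardyDensity u x ≤ (1 / 2) * ∫ x, energyDensity u x := by
  obtain ⟨R, hR, hsR⟩ := hasCompactSupport_bound hs
  have hsp : ∀ r ≥ R, ∀ θ, polarPt r θ ∉ tsupport u := fun r hr θ =>
    hsR _ (by rw [norm_polarPt]; exact hr.trans (le_abs_self r))
  have hdu : Differentiable ℝ u := hu.differentiable (by simp)
  have hW := continuous_arcWeight
  have hp := continuous_polarPt
  have h0 := continuous_pdR hu 0
  have h1 := continuous_pdR hu 1
  have huc := hu.continuous
  have hr : Continuous fun p : ℝ × ℝ => radialDeriv u p.1 p.2 := by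
    unfold radialDeriv; fun_prop
  have ha : Continuous fun p : ℝ × ℝ => angularDeriv u p.1 p.2 := by
    unfold angularDeriv; fun_prop
  rw [integral_hardyDensity_eq huc hR.le (fun x hx => image_eq_zero_of_notMem_tsupport (hsR x hx)),
    integral_eq_integral_polar (R := R)
      (G := fun p => Real.sin p.2 ^ 2 * (p.1 ^ 3 * radialDeriv u p.1 p.2 ^ 2) +
        p.1 * (Real.sin p.2 ^ 2 * angularDeriv u p.1 p.2 ^ 2)) (by fun_prop) hR.le
      (fun r _ θ _ => energyDensity_polar u r θ) (fun r hr θ => by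
        simp [radialDeriv, angularDeriv, pdR_eq_zero (hsp r hr θ)])]
  have hπ : -π ≤ π := by linarith [Real.pi_pos]
  have i1 : Continuous fun p : ℝ × ℝ =>
      Real.sin p.2 ^ 2 * (p.1 ^ 3 * radialDeriv u p.1 p.2 ^ 2) := by fun_prop
  have i2 : Continuous fun p : ℝ × ℝ => p.1 * (Real.sin p.2 ^ 2 * angularDeriv u p.1 p.2 ^ 2) := by
    fun_prop
  have i3 : Continuous fun p : ℝ × ℝ => Real.sin p.2 ^ 2 * (p.1 * u (polarPt p.1 p.2) ^ 2) := by
    fun_prop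
  have i4 : Continuous fun p : ℝ × ℝ => p.1 * (arcWeight p.2 * u (polarPt p.1 p.2) ^ 2) := by
    fun_prop
  have hrad : ∫ r in 0..R, ∫ θ in -π..π, Real.sin θ ^ 2 * (r * u (polarPt r θ) ^ 2) ≤
      ∫ r in 0..R, ∫ θ in -π..π, Real.sin θ ^ 2 * (r ^ 3 * radialDeriv u r θ ^ 2) := by
    rw [integral_swap_of_continuous (F := fun r θ => Real.sin θ ^ 2 * (r * u (polarPt r θ) ^ 2)) i3,
      integral_swap_of_continuous
        (F := fun r θ => Real.sin θ ^ 2 * (r ^ 3 * radialDeriv u r θ ^ 2)) i1]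
    refine integral_integral_mono (i3.comp continuous_swap) (i1.comp continuous_swap) hπ
      fun θ _ => ?_
    simp only [intervalIntegral.integral_const_mul]
    refine mul_le_mul_of_nonneg_left (radial_hardy (fun r => hasDerivAt_radial hdu r θ)
      (hr.comp (Continuous.prodMk_left θ)) hR.le ?_) (sq_nonneg _)
    exact image_eq_zero_of_notMem_tsupport (hsp R le_rfl θ)
  have hang : ∫ r in 0..R, ∫ θ in -π..π, 2 * (r * (arcWeight θ * u (polarPt r θ) ^ 2)) ≤
      ∫ r in 0..R, ∫ θ in -π..π, (r * (Real.sin θ ^ 2 * angularDeriv u r θ ^ 2) +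
        Real.sin θ ^ 2 * (r * u (polarPt r θ) ^ 2)) := by
    refine integral_integral_mono (i4.const_mul 2) (i2.add i3) hR.le fun r hr => ?_
    have := mul_le_mul_of_nonneg_left (angular_hardy (hasDerivAt_angular hdu r)
      (ha.comp (Continuous.prodMk_right r))) hr.1
    simp only [intervalIntegral.integral_const_mul]
    rw [mul_left_comm]
    refine this.trans_eq ?_
    rw [← intervalIntegral.integral_const_mul]
    congr 1
    ext θ
    ring
  rw [integral_integral_add i2 i3] at hang
  rw [integral_integral_add i1 i2]
  simp only [intervalIntegral.integral_const_mul] at hang hrad ⊢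
  linarith

/-- A smooth approximation `η` of the identity on `[0, ∞)` with slope in `[0, 1]` that vanishes
near the origin. -/
lemma exists_smooth_truncation {ε : ℝ} (hε : 0 < ε) :
    ∃ η : ℝ → ℝ, ContDiff ℝ (⊤ : ℕ∞) η ∧ (∀ t, 0 ≤ deriv η t ∧ deriv η t ≤ 1) ∧
      (∀ t ≤ ε, η t = 0) ∧ ∀ t ≥ 0, t ^ 2 - 4 * ε * t ≤ η t ^ 2 := by
  let k : ℝ → ℝ := fun s => Real.smoothTransition (s / ε - 1)
  have hk : ContDiff ℝ (⊤ : ℕ∞) k := Real.smoothTransition.contDiff.comp (by fun_prop)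
  have hkc : Continuous k := hk.continuous
  have hd : ∀ t, HasDerivAt (fun t => ∫ s in 0..t, k s) (k t) t := fun t =>
    hkc.integral_hasStrictDerivAt 0 t |>.hasDerivAt
  have hde : deriv (fun t => ∫ s in 0..t, k s) = k := funext fun t => (hd t).deriv
  refine ⟨fun t => ∫ s in 0..t, k s, ?_, ?_, ?_, ?_⟩
  · rw [contDiff_infty_iff_deriv]
    exact ⟨fun t => (hd t).differentiableAt, by rwa [hde]⟩
  · intro t
    rw [hde]
    exact ⟨Real.smoothTransition.nonneg _, Real.smoothTransition.le_one _⟩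
  · intro t ht
    refine (intervalIntegral.integral_congr (g := fun _ => 0) fun s hs => ?_).trans (by simp)
    have hs : s ≤ ε := (Set.mem_uIcc.1 hs).elim (fun h => h.2.trans ht) fun h => h.2.trans hε.le
    refine Real.smoothTransition.zero_of_nonpos ?_
    rw [sub_nonpos, div_le_one hε]
    exact hs
  · intro t ht
    dsimp only
    rcases le_total t (2 * ε) with h | h
    · nlinarith [sq_nonneg (∫ s in 0..t, k s)]
    · have h1 : 0 ≤ ∫ s in 0..2 * ε, k s := intervalIntegral.integral_nonneg (by positivity)
        fun s _ => Real.smoothTransition.nonneg _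
      have h2 : ∫ s in 2 * ε..t, k s = t - 2 * ε := by
        refine (intervalIntegral.integral_congr (g := fun _ => 1) fun s hs => ?_).trans (by simp)
        rw [Set.uIcc_of_le h] at hs
        refine Real.smoothTransition.one_of_one_le ?_
        rw [le_sub_iff_add_le, le_div_iff₀ hε]
        linarith [hs.1]
      have h3 := intervalIntegral.integral_add_adjacent_intervals
        (hkc.intervalIntegrable 0 (2 * ε) (μ := volume)) (hkc.intervalIntegrable (2 * ε) t)
      nlinarith

/-- Smooth functions of `cos θ` that almost saturate the angular inequality. -/
lemma exists_angular_profile {ε : ℝ} (hε : 0 < ε) :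
    ∃ E : ℝ → ℝ, ContDiff ℝ (⊤ : ℕ∞) E ∧
      π ^ 3 / 3 - 8 * ε * π ≤ ∫ θ in -π..π, arcWeight θ * E (Real.cos θ) ^ 2 ∧
      ∫ θ in -π..π, Real.sin θ ^ 2 *
        ((deriv E (Real.cos θ) * Real.sin θ) ^ 2 + E (Real.cos θ) ^ 2) ≤ 2 * (π ^ 3 / 3) := by
  obtain ⟨η, hη, hη', hη0, hηl⟩ := exists_smooth_truncation hε
  let w : ℝ → ℝ := fun s => π ^ 2 / 4 - Real.arcsin s ^ 2
  let E : ℝ → ℝ := fun s => η (w s) / Real.sqrt (1 - s ^ 2)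
  have hw : Continuous w := by
    have := Real.continuous_arcsin
    fun_prop
  have hE : ContDiff ℝ (⊤ : ℕ∞) E := by
    rw [contDiff_iff_contDiffAt]
    intro s
    by_cases hs : s ^ 2 < 1
    · have h1 : s ≠ 1 := by rintro rfl; norm_num at hs
      have h2 : s ≠ -1 := by rintro rfl; norm_num at hs
      have h3 : 1 - s ^ 2 ≠ 0 := by linarith
      refine ContDiffAt.div ?_ ?_ (Real.sqrt_ne_zero'.2 (by linarith))
      · exact hη.contDiffAt.comp s (contDiffAt_const.sub ((Real.contDiffAt_arcsin h2 h1).pow 2))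
      · exact (contDiffAt_const.sub (contDiffAt_id.pow 2)).sqrt h3
    · have h0 : w s = 0 := by
        rcases le_or_gt 1 s with h | h
        · simp only [w, Real.arcsin_of_one_le h]; ring
        · simp only [w, Real.arcsin_of_le_neg_one (show s ≤ -1 by nlinarith)]; ring
      refine (contDiffAt_const (c := (0 : ℝ))).congr_of_eventuallyEq ?_
      filter_upwards [hw.continuousAt.eventually_lt (continuousAt_const (y := ε)) (h0 ▸ hε)]
        with t ht
      simp [E, hη0 _ ht.le]
  have hw' : ∀ θ ∈ Set.Icc 0 π, w (Real.cos θ) = θ * (π - θ) := fun θ hθ => by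
    simp only [w, arcsin_cos_of_mem hθ]
    ring
  have hEs : ∀ θ ∈ Set.Icc 0 π, E (Real.cos θ) * Real.sin θ = η (θ * (π - θ)) := by
    intro θ hθ
    simp only [E, hw' θ hθ]
    rw [← Real.sin_sq, Real.sqrt_sq (Real.sin_nonneg_of_nonneg_of_le_pi hθ.1 hθ.2)]
    by_cases h : Real.sin θ = 0
    · have : θ * (π - θ) = 0 := by
        by_contra hne
        have h0 : θ ≠ 0 := left_ne_zero_of_mul hne
        have h1 : π - θ ≠ 0 := right_ne_zero_of_mul hne
        exact (Real.sin_pos_of_pos_of_lt_pi (lt_of_le_of_ne hθ.1 h0.symm)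
          (lt_of_le_of_ne hθ.2 fun h => h1 (by simp [h]))).ne' h
      rw [h, this, hη0 0 hε.le, mul_zero]
    · exact div_mul_cancel₀ _ h
  have hEc := hE.continuous
  have hE'c : Continuous (deriv E) := hE.continuous_deriv (by simp)
  have hEd : ∀ s, HasDerivAt E (deriv E s) s := fun s =>
    (hE.differentiable (by simp) s).hasDerivAt
  have hW := continuous_arcWeight
  refine ⟨E, hE, ?_, ?_⟩
  · rw [integral_symm_interval (by fun_prop)]
    simp only [arcWeight_neg, Real.cos_neg]
    have : ∫ θ in 0..π, (θ * (π - θ) - 4 * ε) ≤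
        ∫ θ in 0..π, arcWeight θ * E (Real.cos θ) ^ 2 := by
      refine intervalIntegral.integral_mono_on Real.pi_pos.le
        (Continuous.intervalIntegrable (by fun_prop) _ _)
        (Continuous.intervalIntegrable (by fun_prop) _ _) fun θ hθ => ?_
      rw [arcWeight_eq_of_mem hθ, div_mul_eq_mul_div, ← mul_pow, mul_comm (Real.sin θ), hEs θ hθ]
      have h0 : 0 ≤ θ * (π - θ) := mul_nonneg hθ.1 (sub_nonneg.2 hθ.2)
      rcases h0.eq_or_lt with h | h
      · rw [← h]; simp; positivity
      · rw [le_div_iff₀ h]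
        linarith [hηl _ h0]
    have e : ∫ θ in 0..π, (θ * (π - θ) - 4 * ε) = π ^ 3 / 6 - 4 * ε * π := by
      simp only [mul_sub]
      rw [intervalIntegral.integral_sub (Continuous.intervalIntegrable (by fun_prop) _ _)
        (Continuous.intervalIntegrable (by fun_prop) _ _),
        intervalIntegral.integral_sub (Continuous.intervalIntegrable (by fun_prop) _ _)
        (Continuous.intervalIntegrable (by fun_prop) _ _)]
      simp only [← sq, intervalIntegral.integral_mul_const, integral_id, integral_pow,
        intervalIntegral.integral_const, smul_eq_mul]
      norm_num
      ring
    rw [e] at this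
    linarith
  · rw [integral_symm_interval (by fun_prop)]
    simp only [Real.sin_neg, Real.cos_neg, mul_neg, neg_sq]
    have e : ∫ θ in 0..π, (π - 2 * θ) ^ 2 = π ^ 3 / 3 := by
      have := intervalIntegral.integral_comp_sub_mul (a := 0) (b := π) (fun x : ℝ => x ^ 2)
        (c := 2) (by norm_num) π
      rw [this]
      simp only [integral_pow, smul_eq_mul]
      norm_num
      ring
    have hi : Continuous fun θ => Real.sin θ ^ 2 *
        ((deriv E (Real.cos θ) * Real.sin θ) ^ 2 + E (Real.cos θ) ^ 2) := by fun_prop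
    have hj : Continuous fun θ : ℝ => (π - 2 * θ) ^ 2 := by fun_prop
    have key := intervalIntegral.sub_le_integral_of_hasDeriv_right_of_le (a := 0) (b := π)
      (g := fun θ => E (Real.cos θ) ^ 2 * (Real.sin θ * Real.cos θ))
      (g' := fun θ => 2 * E (Real.cos θ) * (deriv E (Real.cos θ) * -Real.sin θ) *
        (Real.sin θ * Real.cos θ) + E (Real.cos θ) ^ 2 *
          (Real.cos θ * Real.cos θ + Real.sin θ * -Real.sin θ))
      (φ := fun θ => (π - 2 * θ) ^ 2 - Real.sin θ ^ 2 *
        ((deriv E (Real.cos θ) * Real.sin θ) ^ 2 + E (Real.cos θ) ^ 2))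
      Real.pi_pos.le (by fun_prop) (fun θ _ => ?_) (hj.sub hi).integrableOn_Icc (fun θ hθ => ?_)
    · rw [intervalIntegral.integral_sub (hj.intervalIntegrable _ _) (hi.intervalIntegrable _ _),
        e] at key
      simp only [Real.sin_pi, Real.sin_zero] at key
      linarith
    · have h1 : HasDerivAt (fun θ => E (Real.cos θ)) _ θ :=
        (hEd _).comp θ (Real.hasDerivAt_cos θ)
      have := (h1.pow 2).mul ((Real.hasDerivAt_sin θ).mul (Real.hasDerivAt_cos θ))
      refine (this.congr_deriv ?_).hasDerivWithinAt
      simp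
    · have h1 : HasDerivAt (fun θ => E (Real.cos θ) * Real.sin θ)
          (deriv E (Real.cos θ) * -Real.sin θ * Real.sin θ + E (Real.cos θ) * Real.cos θ) θ :=
        ((hEd _).comp θ (Real.hasDerivAt_cos θ)).mul (Real.hasDerivAt_sin θ)
      have hwd : HasDerivAt (fun θ : ℝ => θ * (π - θ)) (π - 2 * θ) θ := by
        have := (hasDerivAt_id θ).mul ((hasDerivAt_id θ).const_sub π)
        refine this.congr_deriv ?_
        simp; ring
      have h2 : HasDerivAt (fun θ => η (θ * (π - θ)))
          (deriv η (θ * (π - θ)) * (π - 2 * θ)) θ :=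
        (hη.differentiable (by simp) _).hasDerivAt.comp θ hwd
      have h3 := h1.unique (h2.congr_of_eventuallyEq (by
        filter_upwards [Ioo_mem_nhds hθ.1 hθ.2] with t ht
        exact hEs t ⟨ht.1.le, ht.2.le⟩))
      have h4 : (deriv η (θ * (π - θ)) * (π - 2 * θ)) ^ 2 ≤ (π - 2 * θ) ^ 2 := by
        rw [mul_pow]
        obtain ⟨h5, h6⟩ := hη' (θ * (π - θ))
        exact mul_le_of_le_one_left (sq_nonneg _) (pow_le_one₀ h5 h6)
      rw [← h3] at h4
      refine le_trans (le_of_eq ?_) (sub_le_sub_right h4 _)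
      ring

/-- Radial functions that almost saturate the weighted Hardy inequality with constant one. -/
lemma exists_radial_profile {δ : ℝ} (hδ : 0 < δ) :
    ∃ φ : ℝ → ℝ, ∃ a > 0, ∃ R > 0, ContDiff ℝ (⊤ : ℕ∞) φ ∧ (∀ r < a, φ r = 0) ∧
      (∀ r ≥ R, φ r = 0 ∧ deriv φ r = 0) ∧ 0 < ∫ r in 0..R, r * φ r ^ 2 ∧
      ∫ r in 0..R, r ^ 3 * deriv φ r ^ 2 ≤ (1 + δ) * ∫ r in 0..R, r * φ r ^ 2 := by
  let χ : ℝ → ℝ := fun t => Real.smoothTransition (1 - t ^ 2)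
  have hχ : ContDiff ℝ (⊤ : ℕ∞) χ := Real.smoothTransition.contDiff.comp (by fun_prop)
  have hχ0 : ∀ t, 1 ≤ t ^ 2 → χ t = 0 := fun t ht =>
    Real.smoothTransition.zero_of_nonpos (by linarith)
  have hχc := hχ.continuous
  have hχ'c : Continuous (deriv χ) := hχ.continuous_deriv (by simp)
  let K := ∫ t in -2..2, χ t ^ 2
  let L := ∫ t in -2..2, deriv χ t ^ 2
  have hK : 0 < K := by
    refine intervalIntegral.integral_pos (by norm_num) (by fun_prop)
      (fun t _ => sq_nonneg _) ⟨0, by norm_num, ?_⟩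
    exact pow_pos (Real.smoothTransition.pos_of_pos (by norm_num)) 2
  have hL : 0 ≤ L := intervalIntegral.integral_nonneg (by norm_num) fun t _ => sq_nonneg _
  obtain ⟨n, hn1, hn⟩ : ∃ n : ℝ, 1 ≤ n ∧ L / n ≤ δ * (n * K) := by
    refine ⟨1 + L / (δ * K), by linarith [div_nonneg hL (by positivity : 0 ≤ δ * K)], ?_⟩
    set m := L / (δ * K) with hm
    have hm0 : 0 ≤ m := by positivity
    have hLm : L = δ * K * m := by rw [hm]; field_simp
    rw [div_le_iff₀ (by linarith), hLm]
    have : 0 < δ * K := by positivity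
    nlinarith [mul_nonneg this.le hm0, mul_nonneg this.le (mul_nonneg hm0 hm0)]
  have hn0 : 0 < n := by linarith
  let φ : ℝ → ℝ := fun r => if 0 < r then χ (Real.log r / n) / r else 0
  have hsmall : ∀ r < Real.exp (-n), φ r = 0 := by
    intro r hr
    by_cases h : 0 < r
    · have : Real.log r / n ≤ -1 := by
        rw [div_le_iff₀ hn0, neg_one_mul]
        exact ((Real.log_lt_iff_lt_exp h).2 hr).le
      simp only [φ, if_pos h]
      rw [hχ0 _ (by nlinarith), zero_div]
    · simp [φ, h]
  have hlarge : ∀ r > Real.exp n, φ r = 0 := by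
    intro r hr
    have h : 0 < r := (Real.exp_pos n).trans hr
    have : 1 ≤ Real.log r / n := by
      rw [le_div_iff₀ hn0, one_mul]
      exact ((Real.lt_log_iff_exp_lt h).2 hr).le
    simp only [φ, if_pos h]
    rw [hχ0 _ (by nlinarith), zero_div]
  have hφeq : ∀ r > 0, φ =ᶠ[nhds r] fun r => χ (Real.log r / n) / r := fun r hr => by
    filter_upwards [Ioi_mem_nhds hr] with t ht
    exact if_pos ht
  have hφ : ContDiff ℝ (⊤ : ℕ∞) φ := by
    rw [contDiff_iff_contDiffAt]
    intro r
    by_cases h : 0 < r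
    · refine ContDiffAt.congr_of_eventuallyEq ?_ (hφeq r h)
      exact (hχ.contDiffAt.comp r ((Real.contDiffAt_log.2 h.ne').div_const n)).div
        contDiffAt_id h.ne'
    · refine (contDiffAt_const (c := (0 : ℝ))).congr_of_eventuallyEq ?_
      filter_upwards [Iio_mem_nhds (show r < Real.exp (-n) by linarith [Real.exp_pos (-n)])]
        with t ht using hsmall t ht
  have hφc := hφ.continuous
  have hφ'c : Continuous (deriv φ) := hφ.continuous_deriv (by simp)
  have hφd : ∀ r, HasDerivAt φ (deriv φ r) r := fun r =>
    (hφ.differentiable (by simp) r).hasDerivAt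
  let a := Real.exp (-(2 * n))
  let R := Real.exp (2 * n)
  have ha : 0 < a := Real.exp_pos _
  have haR : a ≤ R := Real.exp_le_exp.2 (by linarith)
  have han : a < Real.exp (-n) := Real.exp_lt_exp.2 (by linarith)
  have hnR : Real.exp n < R := Real.exp_lt_exp.2 (by linarith)
  have hlargeR : ∀ r ≥ R, φ r = 0 ∧ deriv φ r = 0 := fun r hr => by
    refine ⟨hlarge r (hnR.trans_le hr), ?_⟩
    have : φ =ᶠ[nhds r] fun _ => 0 := by
      filter_upwards [Ioi_mem_nhds (hnR.trans_le hr)] with t ht using hlarge t ht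
    rw [this.deriv_eq, deriv_const]
  have hfd : ∀ r > 0, HasDerivAt (fun r => Real.log r / n) (1 / (n * r)) r := fun r hr => by
    refine ((Real.hasDerivAt_log hr.ne').div_const n).congr_deriv ?_
    field_simp
  have hv : ∀ r > 0, r * φ r = χ (Real.log r / n) := fun r hr => by
    simp only [φ, if_pos hr]
    field_simp
  have hvd : ∀ r > 0, φ r + r * deriv φ r = deriv χ (Real.log r / n) * (1 / (n * r)) := by
    intro r hr
    have h1 := (hasDerivAt_id r).mul (hφd r)
    have h2 := (hχ.differentiable (by simp) (Real.log r / n)).hasDerivAt.comp r (hfd r hr)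
    have h3 := h1.unique (h2.congr_of_eventuallyEq (by
      filter_upwards [Ioi_mem_nhds hr] with t ht using hv t ht))
    simpa using h3
  have hsub : ∀ g : ℝ → ℝ, Continuous g →
      ∫ r in a..R, g (Real.log r / n) * (1 / (n * r)) = ∫ t in -2..2, g t := by
    intro g hg
    have hpos : ∀ r ∈ Set.uIcc a R, 0 < r := fun r hr => by
      rw [Set.uIcc_of_le haR] at hr
      exact ha.trans_le hr.1
    have := intervalIntegral.integral_comp_mul_deriv (a := a) (b := R)
      (f := fun r => Real.log r / n) (f' := fun r => 1 / (n * r)) (g := g)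
      (fun r hr => hfd r (hpos r hr))
      (continuousOn_const.div (by fun_prop) fun r hr => (mul_pos hn0 (hpos r hr)).ne') hg
    simp only [Function.comp_def] at this
    rw [this]
    congr 1 <;> simp only [a, R, Real.log_exp] <;> field_simp
  have hA : ∫ r in 0..R, r * φ r ^ 2 = n * K := by
    have h0 : ∫ r in 0..a, r * φ r ^ 2 = 0 := by
      refine (intervalIntegral.integral_congr (g := fun _ => 0) fun r hr => ?_).trans (by simp)
      rw [Set.uIcc_of_le ha.le] at hr
      simp [hsmall r (hr.2.trans_lt han)]
    rw [← intervalIntegral.integral_add_adjacent_intervals (b := a)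
      (Continuous.intervalIntegrable (by fun_prop) _ _)
      (Continuous.intervalIntegrable (by fun_prop) _ _), h0, zero_add,
      show K = _ from (hsub (fun t => χ t ^ 2) (by fun_prop)).symm,
      ← intervalIntegral.integral_const_mul]
    refine intervalIntegral.integral_congr fun r hr => ?_
    rw [Set.uIcc_of_le haR] at hr
    have hr0 : 0 < r := ha.trans_le hr.1
    simp only [← hv r hr0]
    field_simp
  have hB : ∫ r in 0..R, r * (φ r + r * deriv φ r) ^ 2 = L / n := by
    have h0 : ∫ r in 0..a, r * (φ r + r * deriv φ r) ^ 2 = 0 := by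
      refine (intervalIntegral.integral_congr (g := fun _ => 0) fun r hr => ?_).trans (by simp)
      rw [Set.uIcc_of_le ha.le] at hr
      have h1 := hr.2.trans_lt han
      have : φ =ᶠ[nhds r] fun _ => 0 := by
        filter_upwards [Iio_mem_nhds h1] with t ht using hsmall t ht
      simp [hsmall r h1, this.deriv_eq]
    rw [← intervalIntegral.integral_add_adjacent_intervals (b := a)
      (Continuous.intervalIntegrable (by fun_prop) _ _)
      (Continuous.intervalIntegrable (by fun_prop) _ _), h0, zero_add, div_eq_inv_mul,
      show L = _ from (hsub (fun t => deriv χ t ^ 2) (by fun_prop)).symm,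
      ← intervalIntegral.integral_const_mul]
    refine intervalIntegral.integral_congr fun r hr => ?_
    rw [Set.uIcc_of_le haR] at hr
    have hr0 : 0 < r := ha.trans_le hr.1
    simp only [hvd r hr0]
    field_simp
  refine ⟨φ, a, ha, R, Real.exp_pos _, hφ, fun r hr => hsmall r (hr.trans han), hlargeR, ?_, ?_⟩
  · rw [hA]; positivity
  · have i1 : Continuous fun r => r * φ r ^ 2 := by fun_prop
    have i2 : Continuous fun r => r * (φ r + r * deriv φ r) ^ 2 := by fun_prop
    have i4 : Continuous fun r => r * φ r ^ 2 + r * (φ r + r * deriv φ r) ^ 2 := i1.add i2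
    have i3 : Continuous fun r => r ^ 3 * deriv φ r ^ 2 := by fun_prop
    have key := intervalIntegral.sub_le_integral_of_hasDeriv_right_of_le (a := 0) (b := R)
      (g := fun r => r ^ 2 * φ r ^ 2)
      (g' := fun r => 2 * r * φ r ^ 2 + r ^ 2 * (2 * φ r * deriv φ r))
      (φ := fun r => (r * φ r ^ 2 + r * (φ r + r * deriv φ r) ^ 2) - r ^ 3 * deriv φ r ^ 2)
      (Real.exp_pos _).le (by fun_prop) (fun r _ => ?_) (i4.sub i3).integrableOn_Icc
      (fun r _ => ?_)
    · rw [intervalIntegral.integral_sub (i4.intervalIntegrable _ _)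
        (i3.intervalIntegrable _ _), intervalIntegral.integral_add (i1.intervalIntegrable _ _)
        (i2.intervalIntegrable _ _), hA, hB] at key
      simp only [(hlargeR R le_rfl).1] at key
      rw [hA]
      linarith
    · have := ((hasDerivAt_id r).pow 2).mul ((hφd r).pow 2)
      refine (this.congr_deriv ?_).hasDerivWithinAt
      simp
    · exact le_of_eq (by ring)

/-- The separated function `φ(r) E(cos θ)`. -/
def separated (φ E : ℝ → ℝ) (x : E2) : ℝ := φ ‖x‖ * E (x 0 / ‖x‖)

lemma separated_polar (φ E : ℝ → ℝ) {r : ℝ} (hr : 0 < r) (θ : ℝ) :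
    separated φ E (polarPt r θ) = φ r * E (Real.cos θ) := by
  rw [separated, norm_polarPt, abs_of_pos hr, polarPt_zero, mul_div_cancel_left₀ _ hr.ne']

lemma contDiff_separated {φ E : ℝ → ℝ} (hφ : ContDiff ℝ (⊤ : ℕ∞) φ)
    (hE : ContDiff ℝ (⊤ : ℕ∞) E) {a : ℝ} (ha : 0 < a) (h0 : ∀ r < a, φ r = 0) :
    ContDiff ℝ (⊤ : ℕ∞) (separated φ E) := by
  rw [contDiff_iff_contDiffAt]
  intro x
  by_cases hx : x = 0
  · refine (contDiffAt_const (c := (0 : ℝ))).congr_of_eventuallyEq ?_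
    filter_upwards [Metric.ball_mem_nhds x ha] with y hy
    rw [hx, mem_ball_zero_iff] at hy
    simp [separated, h0 _ hy]
  · have hn : ContDiffAt ℝ (⊤ : ℕ∞) (fun x : E2 => ‖x‖) x := contDiffAt_norm ℝ hx
    have hc : ContDiffAt ℝ (⊤ : ℕ∞) (fun x : E2 => x 0) x :=
      (EuclideanSpace.proj (𝕜 := ℝ) (0 : Fin 2)).contDiff.contDiffAt
    exact (hφ.contDiffAt.comp x hn).mul
      (hE.contDiffAt.comp x (hc.div hn (norm_ne_zero_iff.2 hx)))

lemma hasCompactSupport_separated {φ : ℝ → ℝ} (E : ℝ → ℝ) {R : ℝ} (hR : ∀ r ≥ R, φ r = 0) :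
    HasCompactSupport (separated φ E) := by
  refine HasCompactSupport.intro (isCompact_closedBall (0 : E2) R) fun x hx => ?_
  rw [mem_closedBall_zero_iff, not_le] at hx
  simp [separated, hR _ hx.le]

lemma integral_hardyDensity_separated {φ E : ℝ → ℝ} (hφ : Continuous φ) (hE : Continuous E)
    {R : ℝ} (hR : 0 < R) (hφR : ∀ r ≥ R, φ r = 0) :
    ∫ x, hardyDensity (separated φ E) x =
      (∫ r in 0..R, r * φ r ^ 2) * ∫ θ in -π..π, arcWeight θ * E (Real.cos θ) ^ 2 := by
  have hW := continuous_arcWeight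
  rw [integral_eq_integral_polar (R := R)
    (G := fun p => (p.1 * φ p.1 ^ 2) * (arcWeight p.2 * E (Real.cos p.2) ^ 2)) (by fun_prop) hR.le
    (fun r hr θ hθ => ?_) (fun r hr θ => by simp [hφR r hr])]
  · simp only [intervalIntegral.integral_const_mul, intervalIntegral.integral_mul_const]
  · rw [hardyDensity_polar _ hr hθ, separated_polar φ E hr]
    ring

lemma integral_energyDensity_separated {φ E : ℝ → ℝ} (hφ : ContDiff ℝ (⊤ : ℕ∞) φ)
    (hE : ContDiff ℝ (⊤ : ℕ∞) E) {a : ℝ} (ha : 0 < a) (h0 : ∀ r < a, φ r = 0) {R : ℝ}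
    (hR : 0 < R) (hφR : ∀ r ≥ R, φ r = 0 ∧ deriv φ r = 0) :
    ∫ x, energyDensity (separated φ E) x =
      (∫ r in 0..R, r ^ 3 * deriv φ r ^ 2) *
        (∫ θ in -π..π, Real.sin θ ^ 2 * E (Real.cos θ) ^ 2) +
      (∫ r in 0..R, r * φ r ^ 2) *
        ∫ θ in -π..π, Real.sin θ ^ 2 * (deriv E (Real.cos θ) * Real.sin θ) ^ 2 := by
  have hu : Differentiable ℝ (separated φ E) :=
    (contDiff_separated hφ hE ha h0).differentiable (by simp)
  have hφc := hφ.continuous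
  have hEc := hE.continuous
  have hφ'c : Continuous (deriv φ) := hφ.continuous_deriv (by simp)
  have hE'c : Continuous (deriv E) := hE.continuous_deriv (by simp)
  have hrad : ∀ r > 0, ∀ θ, radialDeriv (separated φ E) r θ = deriv φ r * E (Real.cos θ) := by
    intro r hr θ
    refine (hasDerivAt_radial hu r θ).unique ?_
    refine (((hφ.differentiable (by simp) r).hasDerivAt).mul_const
      (E (Real.cos θ))).congr_of_eventuallyEq ?_
    filter_upwards [Ioi_mem_nhds hr] with t ht using separated_polar φ E ht θ
  have hang : ∀ r > 0, ∀ θ, angularDeriv (separated φ E) r θ =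
      φ r * (deriv E (Real.cos θ) * -Real.sin θ) := by
    intro r hr θ
    refine (hasDerivAt_angular hu r θ).unique ?_
    simp only [separated_polar φ E hr]
    exact (((hE.differentiable (by simp) _).hasDerivAt).comp θ (Real.hasDerivAt_cos θ)).const_mul _
  rw [integral_eq_integral_polar (R := R)
    (G := fun p => (p.1 ^ 3 * deriv φ p.1 ^ 2) * (Real.sin p.2 ^ 2 * E (Real.cos p.2) ^ 2) +
      (p.1 * φ p.1 ^ 2) * (Real.sin p.2 ^ 2 * (deriv E (Real.cos p.2) * Real.sin p.2) ^ 2))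
    (by fun_prop) hR.le (fun r hr θ hθ => ?_) (fun r hr θ => by simp [hφR r hr])]
  · rw [integral_integral_add
      (F := fun r θ => (r ^ 3 * deriv φ r ^ 2) * (Real.sin θ ^ 2 * E (Real.cos θ) ^ 2))
      (G := fun r θ => (r * φ r ^ 2) * (Real.sin θ ^ 2 * (deriv E (Real.cos θ) * Real.sin θ) ^ 2))
      (by fun_prop) (by fun_prop)]
    simp only [intervalIntegral.integral_const_mul, intervalIntegral.integral_mul_const]
  · rw [energyDensity_polar, hrad r hr, hang r hr]
    ring

theorem half_le_of_arcsin_hardy {c : ℝ}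
    (hc : ∀ u : E2 → ℝ, ContDiff ℝ (⊤ : ℕ∞) u → HasCompactSupport u →
      ∫ x, hardyDensity u x ≤ c * ∫ x, energyDensity u x) : 1 / 2 ≤ c := by
  have hπ := Real.pi_pos
  have hangular : ∀ E : ℝ → ℝ, ContDiff ℝ (⊤ : ℕ∞) E →
      ∫ θ in -π..π, arcWeight θ * E (Real.cos θ) ^ 2 ≤
        max c 0 * ∫ θ in -π..π, Real.sin θ ^ 2 *
          ((deriv E (Real.cos θ) * Real.sin θ) ^ 2 + E (Real.cos θ) ^ 2) := by
    intro E hE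
    have hEc := hE.continuous
    have hE'c : Continuous (deriv E) := hE.continuous_deriv (by simp)
    simp only [mul_add]
    rw [intervalIntegral.integral_add (Continuous.intervalIntegrable (by fun_prop) _ _)
      (Continuous.intervalIntegrable (by fun_prop) _ _)]
    set P := ∫ θ in -π..π, arcWeight θ * E (Real.cos θ) ^ 2
    set T := ∫ θ in -π..π, Real.sin θ ^ 2 * (deriv E (Real.cos θ) * Real.sin θ) ^ 2
    set S := ∫ θ in -π..π, Real.sin θ ^ 2 * E (Real.cos θ) ^ 2
    have hT : 0 ≤ T := intervalIntegral.integral_nonneg (by linarith) fun θ _ => by positivity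
    have hS : 0 ≤ S := intervalIntegral.integral_nonneg (by linarith) fun θ _ => by positivity
    have hδ : ∀ δ > 0, P ≤ max c 0 * (T + S) + δ * (max c 0 * S) := by
      intro δ hδ
      obtain ⟨φ, a, ha, R, hR, hφ, h0, hφR, hA, hB⟩ := exists_radial_profile hδ
      have h := hc (separated φ E) (contDiff_separated hφ hE ha h0)
        (hasCompactSupport_separated E fun r hr => (hφR r hr).1)
      rw [integral_hardyDensity_separated hφ.continuous hEc hR fun r hr => (hφR r hr).1,
        integral_energyDensity_separated hφ hE ha h0 hR hφR] at h
      change _ * P ≤ c * (_ * S + _ * T) at h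
      set A := ∫ r in 0..R, r * φ r ^ 2
      set B := ∫ r in 0..R, r ^ 3 * deriv φ r ^ 2
      have hB0 : 0 ≤ B := intervalIntegral.integral_nonneg hR.le fun r hr =>
        mul_nonneg (pow_nonneg hr.1 3) (sq_nonneg _)
      refine le_of_mul_le_mul_left ?_ hA
      calc A * P ≤ c * (B * S + A * T) := h
        _ ≤ max c 0 * (B * S + A * T) :=
          mul_le_mul_of_nonneg_right (le_max_left _ _) (by positivity)
        _ ≤ max c 0 * ((1 + δ) * A * S + A * T) := by
          gcongr
        _ = A * (max c 0 * (T + S) + δ * (max c 0 * S)) := by ring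
    refine le_of_forall_pos_le_add fun e he => ?_
    have hM : 0 ≤ max c 0 * S := by positivity
    refine (hδ (e / (max c 0 * S + 1)) (by positivity)).trans ?_
    gcongr
    rw [div_mul_eq_mul_div, div_le_iff₀ (by positivity)]
    nlinarith
  have hε : ∀ ε > 0, π ^ 3 / 3 ≤ max c 0 * (2 * (π ^ 3 / 3)) + ε * (8 * π) := by
    intro ε hε
    obtain ⟨E, hE, h1, h2⟩ := exists_angular_profile hε
    have h3 := mul_le_mul_of_nonneg_left h2 (le_max_right c 0)
    linarith [hangular E hE]
  have hlim : π ^ 3 / 3 ≤ max c 0 * (2 * (π ^ 3 / 3)) := by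
    refine le_of_forall_pos_le_add fun e he => ?_
    have := hε (e / (8 * π)) (by positivity)
    rwa [div_mul_cancel₀ _ (by positivity)] at this
  have hmax : 1 / 2 ≤ max c 0 := by
    have : 0 < π ^ 3 / 3 := by positivity
    by_contra! h
    nlinarith
  exact (le_max_iff.1 hmax).resolve_right (by norm_num)

/-- The weighted arcsine Hardy inequality on `ℝ²` with the sharp constant `1/2`:
the inequality holds for every test function, and no constant smaller than `1/2`
is admissible. -/
theorem arcsin_hardy_inequality_sharp :
    (∀ u : E2 → ℝ, ContDiff ℝ (⊤ : ℕ∞) u → HasCompactSupport u →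
      (∫ x : E2, (x 1) ^ 2 * (u x) ^ 2 /
          (((x 0) ^ 2 + (x 1) ^ 2) *
            (π ^ 2 / 4 -
              (Real.arcsin (x 0 / Real.sqrt ((x 0) ^ 2 + (x 1) ^ 2))) ^ 2))) ≤
        (1 / 2) * ∫ x : E2, (x 1) ^ 2 * ((pdR 0 u x) ^ 2 + (pdR 1 u x) ^ 2)) ∧
    (∀ c : ℝ,
      (∀ u : E2 → ℝ, ContDiff ℝ (⊤ : ℕ∞) u → HasCompactSupport u →
        (∫ x : E2, (x 1) ^ 2 * (u x) ^ 2 /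
            (((x 0) ^ 2 + (x 1) ^ 2) *
              (π ^ 2 / 4 -
                (Real.arcsin (x 0 / Real.sqrt ((x 0) ^ 2 + (x 1) ^ 2))) ^ 2))) ≤
          c * ∫ x : E2, (x 1) ^ 2 * ((pdR 0 u x) ^ 2 + (pdR 1 u x) ^ 2)) →
      1 / 2 ≤ c) := by
  exact ⟨fun u hu hs => arcsin_hardy_inequality hu hs, fun c hc => half_le_of_arcsin_hardy hc⟩
end
end
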